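/- arXiv:math/0511573 — 2 statements merged into one kernel-verified Lean document; each statement's English description precedes it below -/
import Mathlib

section
/- Let f : ℤ_p → K be uniformly differentiable with derivative f', and suppose that for every n ∈ ℕ and every w ∈ C_{p^n} the Fourier coefficient (f̂_w)_q = I_q(φ_w · f) exists. Then for every x ∈ ℤ_p the limit lim_{n→∞} Σ_{w ∈ C_{p^n}} φ_{w^{-1}}(x) · (f̂_w)_q exists in K, and (L/(q-1)) · lim_{n→∞} Σ_{w ∈ C_{p^n}} φ_{w^{-1}}(x) · (f̂_w)_q = f(x) · q^x. (This is the inversion formula f(x) φ_q(x) = (log q/(q-1)) Σ_w φ_{w^{-1}}(x) (f̂_w)_q for the I_q-Fourier transform.) -/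
open Filter Topology

/-- The exponential power series `exp(x) = ∑ x^n / n!` in a normed field. -/
noncomputable def pExp {K : Type*} [NormedField K] (x : K) : K :=
  ∑' n : ℕ, (n.factorial : K)⁻¹ * x ^ n

/-- The embedding `ℤ_p ⊆ ℚ_p → K`. -/
noncomputable def emb {p : ℕ} [Fact p.Prime] {K : Type*} [NormedField K]
    [Algebra ℚ_[p] K] (x : ℤ_[p]) : K :=
  algebraMap ℚ_[p] K (x : ℚ_[p])

/-- `q^x := exp(x·L)` for `x ∈ ℤ_p`, where `q = exp L`. -/
noncomputable def qpow {p : ℕ} [Fact p.Prime] {K : Type*} [NormedField K]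
    [Algebra ℚ_[p] K] (L : K) (x : ℤ_[p]) : K :=
  pExp (emb x * L)

/-- `[p^N] = (1 - q^{p^N})/(1 - q)` where `q = exp L`. -/
noncomputable def qbracket (p : ℕ) [Fact p.Prime] {K : Type*} [NormedField K]
    [Algebra ℚ_[p] K] (L : K) (N : ℕ) : K :=
  (1 - qpow L ((p : ℤ_[p]) ^ N)) / (1 - pExp L)

/-- The `p`-adic `q`-integral `I_q(f)` exists and equals `I`. -/
def HasIq (p : ℕ) [Fact p.Prime] {K : Type*} [NormedField K] [Algebra ℚ_[p] K]
    (L : K) (f : ℤ_[p] → K) (I : K) : Prop :=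
  Tendsto (fun N : ℕ => (qbracket p L N)⁻¹ *
      ∑ x ∈ Finset.range (p ^ N), f (x : ℤ_[p]) * qpow L ((x : ℤ_[p]))) atTop (nhds I)

/-- `f` is uniformly differentiable with derivative `f'`. -/
def IsUnifDiff {p : ℕ} [Fact p.Prime] {K : Type*} [NormedField K] [Algebra ℚ_[p] K]
    (f f' : ℤ_[p] → K) : Prop :=
  ∀ ε : ℝ, 0 < ε → ∃ δ : ℝ, 0 < δ ∧ ∀ x y : ℤ_[p], 0 < ‖x - y‖ → ‖x - y‖ ≤ δ →
    ‖(f x - f y) / emb (x - y) - f' y‖ ≤ ε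

/-- `φ_w(x) = w^x̄` where `x̄` is the residue of `x` mod `p^n`. -/
noncomputable def phi {p : ℕ} [Fact p.Prime] {K : Type*} [NormedField K]
    (w : K) (n : ℕ) (x : ℤ_[p]) : K :=
  w ^ x.appr n

/-- The `p`-adic invariant integral `I_0(f)` exists and equals `I`. -/
def HasI0 (p : ℕ) [Fact p.Prime] {K : Type*} [NormedField K] [Algebra ℚ_[p] K]
    (f : ℤ_[p] → K) (I : K) : Prop :=
  Tendsto (fun N : ℕ => (algebraMap ℚ_[p] K ((p : ℚ_[p]) ^ N))⁻¹ *
      ∑ x ∈ Finset.range (p ^ N), f (x : ℤ_[p])) atTop (nhds I)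


theorem aux_fac {p : ℕ} [Fact p.Prime] {K : Type*} [NormedField K] [Algebra ℚ_[p] K]
    (hiso : ∀ x : ℚ_[p], ‖algebraMap ℚ_[p] K x‖ = ‖x‖) (n : ℕ) :
    ‖((n + 1).factorial : K)‖⁻¹ ≤ ((p : ℝ) ^ (1 / ((p : ℝ) - 1))) ^ n := by
  have hp : 1 < p := (Fact.out : p.Prime).one_lt
  have hp' : (1 : ℝ) < p := by exact_mod_cast hp
  have h1 : ‖((n + 1).factorial : K)‖ = ‖((n + 1).factorial : ℚ_[p])‖ := by
    rw [← hiso]; simp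
  have h0 : ((n + 1).factorial : ℚ_[p]) ≠ 0 := by
    exact_mod_cast (Nat.factorial_ne_zero (n + 1))
  rw [h1, Padic.norm_eq_zpow_neg_valuation h0, Padic.valuation_natCast, zpow_neg, inv_inv,
    zpow_natCast]
  have h2 := sub_one_mul_padicValNat_factorial_lt_of_ne_zero p (Nat.succ_ne_zero n)
  have h3 : (p - 1) * padicValNat p (n + 1).factorial ≤ n := by
    have := h2; simp only [Nat.succ_eq_add_one] at this; omega
  have h4 : ((p : ℝ) - 1) * (padicValNat p (n + 1).factorial : ℝ) ≤ n := by
    have : (((p - 1) * padicValNat p (n + 1).factorial : ℕ) : ℝ) ≤ n := by exact_mod_cast h3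
    rwa [Nat.cast_mul, Nat.cast_sub hp.le, Nat.cast_one] at this
  rw [← Real.rpow_natCast, ← Real.rpow_natCast, ← Real.rpow_mul (by linarith)]
  apply Real.rpow_le_rpow_of_exponent_le hp'.le
  rw [one_div, inv_mul_eq_div, le_div_iff₀ (by linarith)]
  linarith

theorem aux_pow {K : Type*} [NormedField K] [IsUltrametricDist K] {B : ℝ} (a b : K)
    (ha : ‖a‖ ≤ B) (hb : ‖b‖ ≤ B) (n : ℕ) :
    ‖a ^ (n + 1) - b ^ (n + 1)‖ ≤ ‖a - b‖ * B ^ n := by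
  have hB : 0 ≤ B := (norm_nonneg a).trans ha
  induction n with
  | zero => simp
  | succ n ih =>
    have : a ^ (n + 1 + 1) - b ^ (n + 1 + 1)
      = a ^ (n + 1) * (a - b) + (a ^ (n + 1) - b ^ (n + 1)) * b := by ring
    rw [this]
    refine (IsUltrametricDist.norm_add_le_max _ _).trans (max_le ?_ ?_)
    · rw [norm_mul, norm_pow, mul_comm]
      gcongr
    · rw [norm_mul, pow_succ B, ← mul_assoc]
      gcongr

section
variable {K : Type*} [NormedField K] [CompleteSpace K] [IsUltrametricDist K] {R : ℝ}

theorem aux_term (hR : 0 ≤ R)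
    (hfac : ∀ n : ℕ, ‖((n + 1).factorial : K)‖⁻¹ ≤ R ^ n) {B : ℝ} (a b : K)
    (ha : ‖a‖ ≤ B) (hb : ‖b‖ ≤ B) (n : ℕ) :
    ‖((n + 1).factorial : K)⁻¹ * (a ^ (n + 1) - b ^ (n + 1))‖ ≤ ‖a - b‖ * (B * R) ^ n := by
  have hB : 0 ≤ B := (norm_nonneg a).trans ha
  rw [norm_mul, norm_inv, mul_pow]
  calc _ ≤ R ^ n * (‖a - b‖ * B ^ n) := by
        gcongr
        · exact hfac n
        · exact aux_pow a b ha hb n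
    _ = _ := by ring

theorem aux_summ (hR : 0 ≤ R)
    (hfac : ∀ n : ℕ, ‖((n + 1).factorial : K)‖⁻¹ ≤ R ^ n) (a : K) (ha : ‖a‖ * R < 1) :
    Summable (fun n : ℕ => (n.factorial : K)⁻¹ * a ^ n) := by
  rw [← summable_nat_add_iff 1]
  refine Summable.of_norm_bounded (g := fun n => ‖a‖ * (‖a‖ * R) ^ n) ?_ ?_
  · exact (summable_geometric_of_lt_one (by positivity) ha).mul_left _
  · intro n
    have := aux_term hR hfac a 0 le_rfl (by simp) n
    simpa using this

theorem aux_lip (hR : 0 ≤ R)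
    (hfac : ∀ n : ℕ, ‖((n + 1).factorial : K)‖⁻¹ ≤ R ^ n) {B : ℝ} (hB1 : B * R < 1) (a b : K)
    (ha : ‖a‖ ≤ B) (hb : ‖b‖ ≤ B) : ‖pExp a - pExp b‖ ≤ ‖a - b‖ := by
  have hB : 0 ≤ B := (norm_nonneg a).trans ha
  have sa := aux_summ hR hfac a (lt_of_le_of_lt (by gcongr) hB1)
  have sb := aux_summ hR hfac b (lt_of_le_of_lt (by gcongr) hB1)
  unfold pExp
  rw [← sa.tsum_sub sb]
  refine (IsUltrametricDist.norm_tsum_le _).trans (ciSup_le fun n => ?_)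
  rw [← mul_sub]
  cases n with
  | zero => simp
  | succ n =>
    refine (aux_term hR hfac a b ha hb n).trans ?_
    exact mul_le_of_le_one_right (norm_nonneg _) (pow_le_one₀ (by positivity) hB1.le)

theorem aux_quad (hR : 0 ≤ R)
    (hfac : ∀ n : ℕ, ‖((n + 1).factorial : K)‖⁻¹ ≤ R ^ n) (a : K) (ha : ‖a‖ * R < 1) :
    ‖pExp a - 1 - a‖ ≤ ‖a‖ * (‖a‖ * R) := by
  have sa := aux_summ hR hfac a ha
  have : pExp a - 1 - a = ∑' n : ℕ, ((n + 2).factorial : K)⁻¹ * a ^ (n + 2) := by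
    unfold pExp
    rw [← sa.sum_add_tsum_nat_add 2]
    simp [Finset.sum_range_succ]
    ring
  rw [this]
  refine (IsUltrametricDist.norm_tsum_le _).trans (ciSup_le fun n => ?_)
  have := aux_term hR hfac a 0 le_rfl (by simp) (n + 1)
  simp only [ne_eq, Nat.add_eq_zero_iff, one_ne_zero, and_false, not_false_eq_true, zero_pow,
    sub_zero] at this
  refine this.trans ?_
  gcongr
  rw [pow_succ]
  exact mul_le_of_le_one_left (by positivity) (pow_le_one₀ (by positivity) ha.le)

end

theorem aux_orth {p : ℕ} [Fact p.Prime] {K : Type*} [NormedField K]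
    (C : ℕ → Finset K) (hC : ∀ n : ℕ, ∀ w : K, w ∈ C n ↔ w ^ p ^ n = 1)
    (hCcard : ∀ n : ℕ, (C n).card = p ^ n) (n a b : ℕ) :
    ∑ w ∈ C n, w⁻¹ ^ a * w ^ b = if b ≡ a [MOD p ^ n] then (p : K) ^ n else 0 := by
  have hp : 1 < p := (Fact.out : p.Prime).one_lt
  have hne : ∀ w ∈ C n, w ≠ 0 := by
    rintro w hw rfl
    rw [hC, zero_pow (by positivity)] at hw
    exact zero_ne_one hw
  have hord : ∀ w ∈ C n, orderOf w ∣ p ^ n := fun w hw => orderOf_dvd_of_pow_eq_one ((hC n w).1 hw)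
  split_ifs with h
  · have : ∀ w ∈ C n, w⁻¹ ^ a * w ^ b = 1 := by
      intro w hw
      have h0 := hne w hw
      have : w ^ b = w ^ a := pow_eq_pow_of_modEq (n := p ^ n) h ((hC n w).1 hw)
      rw [this, ← mul_pow, inv_mul_cancel₀ h0, one_pow]
    rw [Finset.sum_congr rfl this]
    simp [hCcard]
  · obtain ⟨w, hw, hwo⟩ : ∃ w ∈ C n, orderOf w = p ^ n := by
      cases n with
      | zero => exact absurd (by simp [Nat.modEq_one]) h
      | succ n =>
        by_contra! hcon
        have hsub : C (n + 1) ⊆ C n := by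
          intro w hw
          by_contra hw'
          exact hcon w hw (orderOf_eq_prime_pow (fun h => hw' ((hC n w).2 h)) ((hC _ w).1 hw))
        have := Finset.card_le_card hsub
        rw [hCcard, hCcard] at this
        exact absurd this (not_le.2 (Nat.pow_lt_pow_right hp n.lt_succ_self))
    have h0 := hne w hw
    set c := w⁻¹ ^ a * w ^ b with hc
    have hc1 : c ≠ 1 := by
      intro h1
      apply h
      rw [← hwo]
      have : w ^ b = w ^ a := by
        rw [hc, inv_pow, inv_mul_eq_one₀ (pow_ne_zero _ h0)] at h1
        exact h1.symm
      rw [← pow_mod_orderOf w b, ← pow_mod_orderOf w a] at this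
      have ho : 0 < orderOf w := by rw [hwo]; positivity
      exact pow_injOn_Iio_orderOf (Nat.mod_lt _ ho) (Nat.mod_lt _ ho) this
    have key : ∑ v ∈ C n, v⁻¹ ^ a * v ^ b = c * ∑ v ∈ C n, v⁻¹ ^ a * v ^ b := by
      rw [Finset.mul_sum]
      symm
      refine Finset.sum_bij (fun v _ => w * v) ?_ ?_ ?_ ?_
      · intro v hv
        rw [hC] at *
        rw [mul_pow, hw, hv, one_mul]
      · intro u _ v _ h
        exact mul_left_cancel₀ h0 h
      · intro v hv
        refine ⟨w⁻¹ * v, ?_, by field_simp⟩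
        rw [hC] at *
        rw [mul_pow, inv_pow, hw, hv, inv_one, one_mul]
      · intro v hv
        rw [hc, mul_inv, mul_pow, mul_pow]; ring
    have : (1 - c) * ∑ v ∈ C n, v⁻¹ ^ a * v ^ b = 0 := by
      rw [sub_mul, one_mul, ← key, sub_self]
    exact (mul_eq_zero.1 this).resolve_left (sub_ne_zero.2 hc1.symm)

theorem aux_range {K : Type*} [AddCommMonoid K] (F : ℕ → K) (m k : ℕ) :
    ∑ i ∈ Finset.range (m * k), F i
      = ∑ j ∈ Finset.range k, ∑ i ∈ Finset.range m, F (m * j + i) := by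
  induction k with
  | zero => simp
  | succ k ih => rw [Nat.mul_succ, Finset.sum_range_add, ih, Finset.sum_range_succ]

theorem aux_appr {p : ℕ} [Fact p.Prime] (n : ℕ) (x : ℤ_[p]) :
    ‖x - (x.appr n : ℤ_[p])‖ ≤ (p : ℝ)⁻¹ ^ n := by
  have := (PadicInt.norm_le_pow_iff_mem_span_pow _ n).2 (PadicInt.appr_spec n x)
  simpa using this

theorem aux_modEq {p : ℕ} [Fact p.Prime] (n a b : ℕ) :
    a ≡ b [MOD p ^ n] ↔ ‖(a : ℤ_[p]) - (b : ℤ_[p])‖ ≤ (p : ℝ)⁻¹ ^ n := by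
  have h := PadicInt.norm_le_pow_iff_mem_span_pow ((a : ℤ_[p]) - (b : ℤ_[p])) n
  have h2 := PadicInt.norm_int_le_pow_iff_dvd (p := p) (k := (a : ℤ) - b) (n := n)
  rw [Nat.ModEq.comm, Nat.modEq_iff_dvd]
  push_cast at h2 ⊢
  rw [← h2]
  simp

theorem aux_apprNat {p : ℕ} [Fact p.Prime] (n a : ℕ) :
    (a : ℤ_[p]).appr n ≡ a [MOD p ^ n] := by
  rw [aux_modEq, norm_sub_rev]
  exact aux_appr n _

theorem aux_fLip {p : ℕ} [Fact p.Prime] {K : Type*} [NormedField K]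
    [IsUltrametricDist K] [Algebra ℚ_[p] K]
    (hiso : ∀ x : ℚ_[p], ‖algebraMap ℚ_[p] K x‖ = ‖x‖)
    (f f' : ℤ_[p] → K) (hf : IsUnifDiff f f') (x : ℤ_[p]) :
    ∃ δ > 0, ∃ M ≥ 0, ∀ y z : ℤ_[p], ‖y - x‖ ≤ δ → ‖z - x‖ ≤ δ → ‖f y - f z‖ ≤ M * ‖y - z‖ := by
  obtain ⟨δ, hδ, h⟩ := hf 1 one_pos
  have hemb : ∀ y : ℤ_[p], ‖(emb y : K)‖ = ‖y‖ := fun y => by rw [emb, hiso]; rfl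
  have hder : ∀ y, ‖y - x‖ ≤ δ → ‖f' y‖ ≤ ‖f' x‖ + 2 := by
    intro y hy
    rcases eq_or_ne y x with rfl | hne
    · linarith
    have h1 := h y x (norm_pos_iff.2 (sub_ne_zero.2 hne)) hy
    have h2 := h x y (norm_pos_iff.2 (sub_ne_zero.2 hne.symm)) (by rwa [norm_sub_rev])
    have e : (f x - f y) / (emb (x - y) : K) = (f y - f x) / emb (y - x) := by
      have : (emb (x - y) : K) = - emb (y - x) := by simp [emb]
      rw [this, ← neg_sub (f y), neg_div_neg_eq]
    rw [e] at h2
    set D := (f y - f x) / (emb (y - x) : K)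
    have : f' y = f' x + (D - f' x) - (D - f' y) := by ring
    rw [this]
    refine (norm_sub_le _ _).trans ?_
    have := norm_add_le (f' x) (D - f' x)
    linarith
  refine ⟨δ, hδ, ‖f' x‖ + 3, by positivity, fun y z hy hz => ?_⟩
  rcases eq_or_ne y z with rfl | hne
  · simp
  have hyz : ‖y - z‖ ≤ δ := by
    have : y - z = (y - x) - (z - x) := by ring
    rw [this, sub_eq_add_neg]
    refine (IsUltrametricDist.norm_add_le_max _ _).trans (max_le hy (by rwa [norm_neg]))
  have hpos := norm_pos_iff.2 (sub_ne_zero.2 hne)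
  have h1 := h y z hpos hyz
  have h3 : ‖(f y - f z) / (emb (y - z) : K)‖ ≤ ‖f' x‖ + 3 := by
    have := norm_add_le ((f y - f z) / (emb (y - z) : K) - f' z) (f' z)
    rw [sub_add_cancel] at this
    have := hder z hz
    linarith
  rwa [norm_div, hemb, div_le_iff₀ hpos] at h3

/-- The weighted partial sums over a residue class. -/
noncomputable def auxA (p : ℕ) [Fact p.Prime] {K : Type*} [NormedField K]
    (g : ℤ_[p] → K) (x : ℤ_[p]) (n N : ℕ) : K :=
  (p : K) ^ n * ((p : K) ^ N)⁻¹ *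
    ∑ y ∈ Finset.range (p ^ N), if y ≡ x.appr n [MOD p ^ n] then g (y : ℤ_[p]) else 0

theorem auxA_bound {p : ℕ} [Fact p.Prime] {K : Type*} [NormedField K]
    [IsUltrametricDist K] (hpn : ‖(p : K)‖ = (p : ℝ)⁻¹)
    (g : ℤ_[p] → K) (x : ℤ_[p]) (δ M : ℝ) (hM : 0 ≤ M)
    (hg : ∀ y z : ℤ_[p], ‖y - x‖ ≤ δ → ‖z - x‖ ≤ δ → ‖g y - g z‖ ≤ M * ‖y - z‖)
    (n : ℕ) (hn : (p : ℝ)⁻¹ ^ n ≤ δ) (k : ℕ) :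
    ‖auxA p g x n (n + k) - g (x.appr n : ℤ_[p])‖ ≤ M * p * (p : ℝ)⁻¹ ^ n := by
  have hp : 0 < p := (Fact.out : p.Prime).pos
  have hp0 : (0 : ℝ) < p := by exact_mod_cast hp
  have hpK : (p : K) ≠ 0 := by
    rw [← norm_pos_iff, hpn]; positivity
  induction k with
  | zero =>
    have : auxA p g x n (n + 0) = g (x.appr n : ℤ_[p]) := by
      unfold auxA
      rw [add_zero, mul_inv_cancel₀ (pow_ne_zero _ hpK), one_mul, Finset.sum_eq_single (x.appr n)]
      · rw [if_pos (Nat.ModEq.refl _)]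
      · intro b hb hne
        rw [if_neg]
        intro h
        exact hne (Nat.ModEq.eq_of_lt_of_lt h (Finset.mem_range.1 hb) (x.appr_lt n))
      · intro h
        exact absurd (Finset.mem_range.2 (x.appr_lt n)) h
    rw [this, sub_self, norm_zero]
    positivity
  | succ k ih =>
    rw [← sub_add_sub_cancel _ (auxA p g x n (n + k)) _]
    refine (IsUltrametricDist.norm_add_le_max _ _).trans (max_le ?_ ih)
    set N := n + k with hN
    set F : ℕ → K := fun y => if y ≡ x.appr n [MOD p ^ n] then g (y : ℤ_[p]) else 0 with hF
    have e : auxA p g x n (n + (k + 1)) - auxA p g x n N = (p : K) ^ n * ((p : K) ^ (N + 1))⁻¹ *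
        ∑ j ∈ Finset.range p, ∑ y ∈ Finset.range (p ^ N), (F (p ^ N * j + y) - F y) := by
      unfold auxA
      rw [← add_assoc, ← hN, pow_succ p N]
      simp only [← hF]
      rw [show (∑ y ∈ Finset.range (p ^ N * p), if y ≡ x.appr n [MOD p ^ n] then g (y : ℤ_[p]) else 0)
        = ∑ y ∈ Finset.range (p ^ N * p), F y from rfl, aux_range]
      simp only [Finset.sum_sub_distrib, Finset.sum_const, Finset.card_range, nsmul_eq_mul]
      field_simp
      rw [hF]
      ring
    rw [e, norm_mul, norm_mul, norm_inv, norm_pow, norm_pow, hpn]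
    have hsum : ‖∑ j ∈ Finset.range p, ∑ y ∈ Finset.range (p ^ N), (F (p ^ N * j + y) - F y)‖
        ≤ M * (p : ℝ)⁻¹ ^ N := by
      refine IsUltrametricDist.norm_sum_le_of_forall_le_of_nonneg (by positivity) fun j _ => ?_
      refine IsUltrametricDist.norm_sum_le_of_forall_le_of_nonneg (by positivity) fun y _ => ?_
      have hmod : p ^ N * j + y ≡ y [MOD p ^ N] := by
        simp [Nat.ModEq]
      have hmod' : p ^ N * j + y ≡ y [MOD p ^ n] :=
        hmod.of_dvd (pow_dvd_pow p (by omega))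
      have close : ∀ z : ℕ, z ≡ x.appr n [MOD p ^ n] → ‖(z : ℤ_[p]) - x‖ ≤ δ := by
        intro z hz
        rw [aux_modEq] at hz
        refine le_trans ?_ hn
        rw [← sub_add_sub_cancel _ (x.appr n : ℤ_[p]) _]
        refine (IsUltrametricDist.norm_add_le_max _ _).trans (max_le hz ?_)
        rw [norm_sub_rev]; exact aux_appr n x
      by_cases hy : y ≡ x.appr n [MOD p ^ n]
      · simp only [hF, if_pos hy, if_pos (hmod'.trans hy)]
        refine (hg _ _ (close _ (hmod'.trans hy)) (close _ hy)).trans ?_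
        gcongr
        exact (aux_modEq _ _ _).1 hmod
      · have : ¬ (p ^ N * j + y ≡ x.appr n [MOD p ^ n]) := fun h => hy (hmod'.symm.trans h)
        simp only [hF, if_neg hy, if_neg this, sub_zero, norm_zero]
        positivity
    calc _ ≤ (p : ℝ)⁻¹ ^ n * ((p : ℝ)⁻¹ ^ (N + 1))⁻¹ * (M * (p : ℝ)⁻¹ ^ N) := by gcongr
      _ = M * p * (p : ℝ)⁻¹ ^ n := by
        rw [pow_succ]; field_simp

/-- Inversion formula for the `I_q`-Fourier transform:
`f(x) φ_q(x) = (log q/(q-1)) Σ_w φ_{w⁻¹}(x) (f̂_w)_q`. -/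
theorem stmt0 {p : ℕ} [Fact p.Prime] {K : Type*} [NormedField K] [CompleteSpace K]
    [IsUltrametricDist K] [Algebra ℚ_[p] K]
    (hiso : ∀ x : ℚ_[p], ‖algebraMap ℚ_[p] K x‖ = ‖x‖)
    (L : K) (hL0 : 0 < ‖L‖) (hL1 : ‖L‖ < (p : ℝ) ^ (-1 / ((p : ℝ) - 1)))
    (C : ℕ → Finset K) (hC : ∀ n : ℕ, ∀ w : K, w ∈ C n ↔ w ^ p ^ n = 1)
    (hCcard : ∀ n : ℕ, (C n).card = p ^ n)
    (f f' : ℤ_[p] → K) (hf : IsUnifDiff f f')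
    (fc : K → K)
    (hfc : ∀ (n : ℕ) (w : K), w ^ p ^ n = 1 →
      HasIq p L (fun x => phi w n x * f x) (fc w)) :
    ∀ x : ℤ_[p], ∃ S : K,
      Tendsto (fun n : ℕ => ∑ w ∈ C n, phi w⁻¹ n x * fc w) atTop (nhds S) ∧
      (L / (pExp L - 1)) * S = f x * qpow L x := by
  intro x
  have hp : 1 < p := (Fact.out : p.Prime).one_lt
  have hp1 : (1 : ℝ) < p := by exact_mod_cast hp
  have hp0 : (0 : ℝ) < p := by linarith
  have hpn : ‖(p : K)‖ = (p : ℝ)⁻¹ := by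
    have := hiso (p : ℚ_[p])
    rw [map_natCast, Padic.norm_p] at this
    exact this
  have hpK : (p : K) ≠ 0 := by
    rw [← norm_pos_iff, hpn]; positivity
  have hLne : L ≠ 0 := norm_pos_iff.1 hL0
  have hemb : ∀ y : ℤ_[p], ‖(emb y : K)‖ = ‖y‖ := fun y => by rw [emb, hiso]; rfl
  set R : ℝ := (p : ℝ) ^ (1 / ((p : ℝ) - 1)) with hRdef
  have hRpos : 0 < R := Real.rpow_pos_of_pos hp0 _
  have hR := hRpos.le
  have hLR : ‖L‖ * R < 1 := by
    have : (p : ℝ) ^ (-1 / ((p : ℝ) - 1)) = R⁻¹ := by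
      rw [neg_div, Real.rpow_neg hp0.le]
    rw [this] at hL1
    calc ‖L‖ * R < R⁻¹ * R := by gcongr
      _ = 1 := inv_mul_cancel₀ hRpos.ne'
  have hfac : ∀ n : ℕ, ‖((n + 1).factorial : K)‖⁻¹ ≤ R ^ n := aux_fac hiso
  -- `q ≠ 1`
  have hq : pExp L - 1 ≠ 0 := by
    intro h
    have := aux_quad hR hfac L hLR
    rw [h, zero_sub, norm_neg] at this
    nlinarith
  set c : K := (pExp L - 1) / L with hc
  have hcne : c ≠ 0 := div_ne_zero hq hLne
  -- the normalising factor
  have hu : Tendsto (fun N : ℕ => (qbracket p L N)⁻¹ * (p : K) ^ N) atTop (nhds c) := by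
    have h1 : Tendsto (fun N : ℕ => (pExp ((p : K) ^ N * L) - 1) / ((p : K) ^ N * L))
        atTop (nhds 1) := by
      rw [tendsto_iff_norm_sub_tendsto_zero]
      have hlim : Tendsto (fun N : ℕ => (p : ℝ)⁻¹ ^ N * (‖L‖ * R)) atTop (nhds 0) := by
        have := (tendsto_pow_atTop_nhds_zero_of_lt_one (r := (p : ℝ)⁻¹) (by positivity)
          (inv_lt_one_of_one_lt₀ hp1)).mul_const (‖L‖ * R)
        simpa using this
      refine squeeze_zero (fun _ => norm_nonneg _) (fun N => ?_) hlim
      have hne : (p : K) ^ N * L ≠ 0 := mul_ne_zero (pow_ne_zero _ hpK) hLne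
      have hnorm : ‖(p : K) ^ N * L‖ = (p : ℝ)⁻¹ ^ N * ‖L‖ := by rw [norm_mul, norm_pow, hpn]
      have hle : (p : ℝ)⁻¹ ^ N ≤ 1 := pow_le_one₀ (by positivity) (inv_le_one_of_one_le₀ hp1.le)
      have hlt : ‖(p : K) ^ N * L‖ * R < 1 := by
        rw [hnorm, mul_assoc]
        exact lt_of_le_of_lt (mul_le_of_le_one_left (by positivity) hle) hLR
      have hb := aux_quad hR hfac _ hlt
      rw [div_sub_one hne, norm_div, div_le_iff₀ (norm_pos_iff.2 hne)]
      refine hb.trans_eq ?_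
      rw [hnorm]; ring
    have h2 := (h1.inv₀ one_ne_zero).const_mul c
    rw [inv_one, mul_one] at h2
    refine h2.congr fun N => ?_
    have e : (emb ((p : ℤ_[p]) ^ N) : K) = (p : K) ^ N := by simp [emb]
    rw [qbracket, qpow, e, hc, inv_div, inv_div, ← neg_sub (pExp L) 1,
      ← neg_sub (pExp ((p : K) ^ N * L)) 1, neg_div_neg_eq]
    field_simp
  -- Lipschitz bound for `g = f * q^x` near `x`
  set g : ℤ_[p] → K := fun y => f y * qpow L y with hgdef
  obtain ⟨δ, hδ, M, hM, hg⟩ : ∃ δ > 0, ∃ M ≥ 0, ∀ y z : ℤ_[p], ‖y - x‖ ≤ δ → ‖z - x‖ ≤ δ →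
      ‖g y - g z‖ ≤ M * ‖y - z‖ := by
    obtain ⟨δ, hδ, M, hM, hfl⟩ := aux_fLip hiso f f' hf x
    have hle : ∀ y : ℤ_[p], ‖(emb y : K) * L‖ ≤ ‖L‖ := fun y => by
      rw [norm_mul, hemb]
      exact mul_le_of_le_one_left (norm_nonneg _) y.norm_le_one
    have hL1' : ‖L‖ ≤ ‖L‖ := le_rfl
    have hql : ∀ y z : ℤ_[p], ‖qpow L y - qpow L z‖ ≤ ‖L‖ * ‖y - z‖ := fun y z => by
      refine (aux_lip hR hfac hLR _ _ (hle y) (hle z)).trans_eq ?_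
      have : (emb y * L - emb z * L : K) = emb (y - z) * L := by simp [emb, sub_mul]
      rw [this, norm_mul, hemb, mul_comm]
    have hqb : ∀ y : ℤ_[p], ‖qpow L y‖ ≤ ‖L‖ + ‖qpow L (0 : ℤ_[p])‖ := fun y => by
      have h1 := hql y 0
      have h2 := norm_le_norm_sub_add (qpow L y) (qpow L (0 : ℤ_[p]))
      have h3 : ‖L‖ * ‖y - 0‖ ≤ ‖L‖ := mul_le_of_le_one_right (norm_nonneg _) (PadicInt.norm_le_one _)
      linarith
    have hfb : ∀ y : ℤ_[p], ‖y - x‖ ≤ δ → ‖f y‖ ≤ M + ‖f x‖ := fun y hy => by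
      have h1 := hfl y x hy (by simpa using hδ.le)
      have h2 := norm_le_norm_sub_add (f y) (f x)
      have h3 : M * ‖y - x‖ ≤ M := mul_le_of_le_one_right hM (PadicInt.norm_le_one _)
      linarith
    refine ⟨δ, hδ, M * (‖L‖ + ‖qpow L (0 : ℤ_[p])‖) + (M + ‖f x‖) * ‖L‖, by positivity,
      fun y z hy hz => ?_⟩
    have : g y - g z = (f y - f z) * qpow L y + f z * (qpow L y - qpow L z) := by
      simp only [hgdef]; ring
    rw [this]
    calc _ ≤ ‖f y - f z‖ * ‖qpow L y‖ + ‖f z‖ * ‖qpow L y - qpow L z‖ := by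
          rw [← norm_mul, ← norm_mul]; exact norm_add_le _ _
      _ ≤ (M * ‖y - z‖) * (‖L‖ + ‖qpow L (0 : ℤ_[p])‖) + (M + ‖f x‖) * (‖L‖ * ‖y - z‖) := by
          gcongr
          · exact hfl y z hy hz
          · exact hqb y
          · exact hfb z hz
          · exact hql y z
      _ = _ := by ring
  -- the partial sums
  set S : ℕ → K := fun n => ∑ w ∈ C n, phi w⁻¹ n x * fc w with hS
  have hSlim : ∀ n, Tendsto (fun N => (qbracket p L N)⁻¹ * (p : K) ^ N * auxA p g x n N)
      atTop (nhds (S n)) := by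
    intro n
    have h1 : Tendsto (fun N : ℕ => ∑ w ∈ C n, phi w⁻¹ n x * ((qbracket p L N)⁻¹ *
        ∑ y ∈ Finset.range (p ^ N), phi w n (y : ℤ_[p]) * f (y : ℤ_[p]) * qpow L (y : ℤ_[p])))
        atTop (nhds (S n)) := by
      refine tendsto_finsetSum _ fun w hw => ?_
      exact (hfc n w ((hC n w).1 hw)).const_mul _
    refine h1.congr fun N => ?_
    have h2 : ∀ w ∈ C n, phi w⁻¹ n x * ((qbracket p L N)⁻¹ *
        ∑ y ∈ Finset.range (p ^ N), phi w n (y : ℤ_[p]) * f (y : ℤ_[p]) * qpow L (y : ℤ_[p]))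
        = ∑ y ∈ Finset.range (p ^ N), (qbracket p L N)⁻¹ * g (y : ℤ_[p]) *
          (w⁻¹ ^ x.appr n * w ^ y) := by
      intro w hw
      rw [Finset.mul_sum, Finset.mul_sum]
      refine Finset.sum_congr rfl fun y _ => ?_
      have : phi w n (y : ℤ_[p]) = w ^ y :=
        pow_eq_pow_of_modEq (aux_apprNat n y) ((hC n w).1 hw)
      rw [this, phi]
      simp only [hgdef]
      ring
    rw [Finset.sum_congr rfl h2, Finset.sum_comm]
    simp only [← Finset.mul_sum]
    rw [auxA]
    have h3 : ∀ y : ℕ, (qbracket p L N)⁻¹ * g (y : ℤ_[p]) * ∑ w ∈ C n, w⁻¹ ^ x.appr n * w ^ y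
        = (qbracket p L N)⁻¹ * (p : K) ^ n *
          (if y ≡ x.appr n [MOD p ^ n] then g (y : ℤ_[p]) else 0) := by
      intro y
      rw [aux_orth C hC hCcard]
      split_ifs <;> ring
    simp only [h3, ← Finset.mul_sum]
    have : (p : K) ^ N ≠ 0 := pow_ne_zero _ hpK
    field_simp
  have hAlim : ∀ n, Tendsto (fun N => auxA p g x n N) atTop (nhds (S n / c)) := by
    intro n
    have h1 := (hSlim n).div hu hcne
    refine h1.congr' ?_
    filter_upwards [hu.eventually_ne hcne] with N hN
    exact mul_div_cancel_left₀ _ hN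
  have hpow : Tendsto (fun n : ℕ => (p : ℝ)⁻¹ ^ n) atTop (nhds 0) :=
    tendsto_pow_atTop_nhds_zero_of_lt_one (by positivity) (inv_lt_one_of_one_lt₀ hp1)
  have hfin : Tendsto (fun n => S n / c) atTop (nhds (g x)) := by
    rw [tendsto_iff_norm_sub_tendsto_zero]
    have hz : Tendsto (fun n : ℕ => (M * p + M) * (p : ℝ)⁻¹ ^ n) atTop (nhds 0) := by
      simpa using hpow.const_mul (M * p + M)
    refine squeeze_zero' (Eventually.of_forall fun _ => norm_nonneg _) ?_ hz
    filter_upwards [hpow.eventually (ge_mem_nhds hδ)] with n hn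
    have h1 : ‖S n / c - g (x.appr n : ℤ_[p])‖ ≤ M * p * (p : ℝ)⁻¹ ^ n := by
      have hl := ((hAlim n).sub_const (g (x.appr n : ℤ_[p]))).norm
      refine le_of_tendsto hl ?_
      filter_upwards [eventually_ge_atTop n] with N hN
      obtain ⟨k, rfl⟩ := Nat.exists_eq_add_of_le hN
      exact auxA_bound hpn g x δ M hM hg n hn k
    have ha : ‖(x.appr n : ℤ_[p]) - x‖ ≤ (p : ℝ)⁻¹ ^ n := by
      rw [norm_sub_rev]; exact aux_appr n x
    have h2 : ‖g (x.appr n : ℤ_[p]) - g x‖ ≤ M * (p : ℝ)⁻¹ ^ n := by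
      refine (hg _ _ (ha.trans hn) (by simpa using hδ.le)).trans ?_
      gcongr
    have h3 := norm_sub_le_norm_sub_add_norm_sub (S n / c) (g (x.appr n : ℤ_[p])) (g x)
    linarith
  refine ⟨g x * c, ?_, ?_⟩
  · refine (hfin.mul_const c).congr fun n => ?_
    exact div_mul_cancel₀ _ hcne
  · rw [hc]
    simp only [hgdef]
    field_simp
end

section
/- Let f, g : ℤ_p → K be uniformly differentiable with derivatives f', g', and let F : ℤ_p → K be uniformly differentiable with derivative F' = f. Assume: all twisted coefficients (f̂_{wq^{-1}})_q, (ĝ_{wq^{-1}})_q, (F̂_{wq^{-1}})_q exist; for every z ∈ ℤ_p the limits defining (f *_q g)(z) and (F *_q g)(z) exist; F *_q g is uniformly differentiable with derivative (F *_q g)'; and for every z ∈ ℤ_p the q-integral A(z) := I_q(x ↦ f(x) g(z-x) q^{-x}) exists. Then for every z ∈ ℤ_p: (f *_q g)(z) = ((q-1)/L) · A(z) + (F *_q g)'(z). (With f ⊗_q g' := -(F *_q g)', this is Kim's formula f *_q g(z) = ((q-1)/log q) I_q^{(x)}(f(x) g(z-x) φ_{q^{-1}}(x)) - (f ⊗_q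 g')(z).) -/
open Filter Topology

open Filter Topology

section basics
variable {p : ℕ} [hp : Fact p.Prime] {K : Type*} [NormedField K] [Algebra ℚ_[p] K]

noncomputable def embR (p : ℕ) [Fact p.Prime] (K : Type*) [NormedField K] [Algebra ℚ_[p] K] :
    ℤ_[p] →+* K := (algebraMap ℚ_[p] K).comp PadicInt.Coe.ringHom

lemma emb_eq (x : ℤ_[p]) : (emb x : K) = embR p K x := rfl
lemma emb_natCast (n : ℕ) : (emb (n : ℤ_[p]) : K) = n := by rw [emb_eq, map_natCast]
lemma emb_intCast (n : ℤ) : (emb (n : ℤ_[p]) : K) = n := by rw [emb_eq, map_intCast]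
lemma emb_add (x y : ℤ_[p]) : (emb (x + y) : K) = emb x + emb y := by simp only [emb_eq, map_add]
lemma emb_sub (x y : ℤ_[p]) : (emb (x - y) : K) = emb x - emb y := by simp only [emb_eq, map_sub]
lemma emb_mul (x y : ℤ_[p]) : (emb (x * y) : K) = emb x * emb y := by simp only [emb_eq, map_mul]
lemma emb_neg (x : ℤ_[p]) : (emb (-x) : K) = -emb x := by simp only [emb_eq, map_neg]
lemma emb_zero : (emb (0 : ℤ_[p]) : K) = 0 := by simp only [emb_eq, map_zero]
lemma emb_one : (emb (1 : ℤ_[p]) : K) = 1 := by simp only [emb_eq, map_one]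
lemma emb_ppow (n : ℕ) : (emb ((p : ℤ_[p]) ^ n) : K) = (p : K) ^ n := by
  simp only [emb_eq, map_pow, map_natCast]

variable (hiso : ∀ x : ℚ_[p], ‖algebraMap ℚ_[p] K x‖ = ‖x‖)
include hiso

lemma norm_emb (x : ℤ_[p]) : ‖(emb x : K)‖ = ‖x‖ := by
  rw [emb, hiso]; rfl

lemma norm_emb_le (x : ℤ_[p]) : ‖(emb x : K)‖ ≤ 1 := by
  rw [norm_emb hiso]; exact PadicInt.norm_le_one x

lemma norm_nat_le (n : ℕ) : ‖(n : K)‖ ≤ 1 := by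
  rw [← emb_natCast (p := p)]; exact norm_emb_le hiso _

lemma norm_int_le (n : ℤ) : ‖(n : K)‖ ≤ 1 := by
  rw [← emb_intCast (p := p)]; exact norm_emb_le hiso _

lemma norm_p : ‖(p : K)‖ = (p : ℝ)⁻¹ := by
  rw [← emb_natCast (p := p), norm_emb hiso]; simp

lemma norm_ppow (n : ℕ) : ‖(p : K) ^ n‖ = ((p : ℝ) ^ n)⁻¹ := by
  rw [norm_pow, norm_p hiso, inv_pow]

omit hiso in
lemma norm_Zppow (n : ℕ) : ‖(p : ℤ_[p]) ^ n‖ = ((p : ℝ) ^ n)⁻¹ := by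
  rw [PadicInt.norm_p_pow]; simp

omit [Algebra ℚ_[p] K] hiso in
lemma charZ [Algebra ℚ_[p] K] : CharZero K :=
  charZero_of_injective_algebraMap (algebraMap ℚ_[p] K).injective

lemma p_ne : (p : K) ≠ 0 := by
  rw [← norm_ne_zero_iff, norm_p hiso]
  have := hp.out.pos
  positivity

lemma norm_half_le : ‖(2 : K)⁻¹‖ ≤ 2 := by
  have h2 : ‖(2 : K)⁻¹‖ = ‖(2 : ℚ_[p])‖⁻¹ := by
    rw [norm_inv, ← hiso, map_ofNat]
  rw [h2]
  by_cases h : p = 2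
  · subst h
    have : ‖((2 : ℕ) : ℚ_[2])‖ = (2 : ℝ)⁻¹ := by simpa using (Padic.norm_p (p := 2))
    rw [show (2 : ℚ_[2]) = ((2 : ℕ) : ℚ_[2]) by norm_num, this]; norm_num
  · have : ‖((2 : ℕ) : ℚ_[p])‖ = 1 := by
      rw [Padic.norm_natCast_eq_one_iff]
      exact (Nat.coprime_primes hp.out Nat.prime_two).2 h
    rw [show (2 : ℚ_[p]) = ((2 : ℕ) : ℚ_[p]) by norm_num, this]; norm_num

/-! ### the exponential -/

lemma term_bound (x : K) (n : ℕ) :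
    ‖((n + 1).factorial : K)⁻¹ * x ^ (n + 1)‖ ≤
      ‖x‖ * (‖x‖ * (p : ℝ) ^ (1 / ((p : ℝ) - 1))) ^ n := by
  have hp1 : (1 : ℝ) < p := by exact_mod_cast hp.out.one_lt
  have hnorm : ‖((n + 1).factorial : K)‖ = ((p : ℝ) ^ (padicValNat p (n + 1).factorial))⁻¹ := by
    have : ((n + 1).factorial : K) = algebraMap ℚ_[p] K ((n + 1).factorial : ℚ_[p]) := by simp
    rw [this, hiso, Padic.norm_eq_zpow_neg_valuation (by exact_mod_cast (n + 1).factorial_ne_zero)]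
    rw [Padic.valuation_natCast, zpow_neg, zpow_natCast]
  have hv : (p - 1) * padicValNat p (n + 1).factorial ≤ n := by
    have := sub_one_mul_padicValNat_factorial_lt_of_ne_zero p (n := n + 1) (by omega)
    omega
  have hR : ((p : ℝ) ^ (padicValNat p (n + 1).factorial)) ≤ ((p : ℝ) ^ (1 / ((p : ℝ) - 1))) ^ n := by
    rw [← Real.rpow_natCast, ← Real.rpow_mul_natCast (by positivity)]
    apply Real.rpow_le_rpow_of_exponent_le hp1.le
    rw [div_mul_eq_mul_div, one_mul, le_div_iff₀ (by linarith)]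
    have h2 : ((p - 1 : ℕ) : ℝ) = (p : ℝ) - 1 := by
      rw [Nat.cast_sub hp.out.one_lt.le]; simp
    rw [← h2, mul_comm]
    exact_mod_cast hv
  rw [norm_mul, norm_inv, hnorm, inv_inv, norm_pow, mul_pow, pow_succ]
  calc _ ≤ ((p : ℝ) ^ (1 / ((p : ℝ) - 1))) ^ n * (‖x‖ ^ n * ‖x‖) := by gcongr
    _ = _ := by ring

lemma rho_lt {x : K} (hx : ‖x‖ < (p : ℝ) ^ (-1 / ((p : ℝ) - 1))) :
    ‖x‖ * (p : ℝ) ^ (1 / ((p : ℝ) - 1)) < 1 := by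
  have hp1 : (1 : ℝ) < p := by exact_mod_cast hp.out.one_lt
  have : (p : ℝ) ^ (-1 / ((p : ℝ) - 1)) * (p : ℝ) ^ (1 / ((p : ℝ) - 1)) = 1 := by
    rw [← Real.rpow_add (by linarith), neg_div, neg_add_cancel, Real.rpow_zero]
  have h2 : (0 : ℝ) < (p : ℝ) ^ (1 / ((p : ℝ) - 1)) := Real.rpow_pos_of_pos (by linarith) _
  exact (mul_lt_mul_of_pos_right hx h2).trans_eq this

lemma exp_summable {x : K} (hx : ‖x‖ < (p : ℝ) ^ (-1 / ((p : ℝ) - 1))) :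
    Summable fun n : ℕ => ‖(n.factorial : K)⁻¹ * x ^ n‖ := by
  rw [← summable_nat_add_iff 1]
  refine Summable.of_nonneg_of_le (fun _ => norm_nonneg _) (term_bound hiso x) ?_
  exact (summable_geometric_of_lt_one (by positivity) (rho_lt hiso hx)).mul_left _

variable [CompleteSpace K] [IsUltrametricDist K]

lemma exp_sub_bound {x : K} (hx : ‖x‖ < (p : ℝ) ^ (-1 / ((p : ℝ) - 1))) :
    ‖pExp x - 1 - x‖ ≤ ‖x‖ * (‖x‖ * (p : ℝ) ^ (1 / ((p : ℝ) - 1))) := by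
  have hs := (exp_summable hiso hx).of_norm
  have h : pExp x - 1 - x = ∑' n : ℕ, ((n + 2).factorial : K)⁻¹ * x ^ (n + 2) := by
    rw [pExp, ← hs.sum_add_tsum_nat_add 2]
    simp [Finset.sum_range_succ]
    ring
  rw [h]
  apply IsUltrametricDist.norm_tsum_le_of_forall_le
  intro n
  refine (term_bound hiso x (n + 1)).trans ?_
  gcongr
  rw [pow_succ]
  apply mul_le_of_le_one_left (by positivity)
  exact pow_le_one₀ (by positivity) (rho_lt hiso hx).le

lemma pExp_mul_neg {x : K} (hx : ‖x‖ < (p : ℝ) ^ (-1 / ((p : ℝ) - 1))) :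
    pExp (-x) * pExp x = 1 := by
  have : CharZero K := charZ (p := p)
  have hs := exp_summable hiso hx
  have hs' := exp_summable hiso (x := -x) (by rwa [norm_neg])
  rw [pExp, pExp, tsum_mul_tsum_eq_tsum_sum_antidiagonal_of_summable_norm hs' hs]
  rw [tsum_eq_single 0]
  · simp
  · intro n hn
    have key : ∑ kl ∈ Finset.HasAntidiagonal.antidiagonal n, (kl.1.factorial : K)⁻¹ * (-x) ^ kl.1 *
        ((kl.2.factorial : K)⁻¹ * x ^ kl.2) = (n.factorial : K)⁻¹ * (-x + x) ^ n := by
      rw [Commute.add_pow' (Commute.all _ _), Finset.mul_sum]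
      refine Finset.sum_congr rfl fun kl hkl => ?_
      obtain ⟨i, j⟩ := kl
      rw [Finset.HasAntidiagonal.mem_antidiagonal] at hkl
      simp only at hkl ⊢
      subst hkl
      have h1 : (((i + j).choose i : ℕ) : K) * i.factorial * j.factorial = (i + j).factorial := by
        have := Nat.add_choose_mul_factorial_mul_factorial i j
        rw [← Nat.choose_symm_add] at this
        exact_mod_cast this
      have a1 : (i.factorial : K) ≠ 0 := by exact_mod_cast i.factorial_ne_zero
      have a2 : (j.factorial : K) ≠ 0 := by exact_mod_cast j.factorial_ne_zero
      have a3 : ((i + j).factorial : K) ≠ 0 := by exact_mod_cast (i + j).factorial_ne_zero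
      rw [nsmul_eq_mul]
      field_simp
      rw [← h1]; ring
    rw [key]; simp [hn]

variable {L : K} (hL0 : 0 < ‖L‖) (hL1 : ‖L‖ < (p : ℝ) ^ (-1 / ((p : ℝ) - 1)))
include hL1

lemma qpow_neg_mul (x : ℤ_[p]) : qpow L (-x) * qpow L x = 1 := by
  rw [qpow, qpow, emb_neg, neg_mul]
  apply pExp_mul_neg hiso
  rw [norm_mul]
  exact (mul_le_of_le_one_left (norm_nonneg _) (norm_emb_le hiso x)).trans_lt hL1

include hL0

lemma exp_ne_one : pExp L - 1 ≠ 0 := by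
  intro h
  have := exp_sub_bound hiso hL1
  rw [h, zero_sub, norm_neg] at this
  have h2 := mul_lt_mul_of_pos_left (rho_lt hiso hL1) hL0
  linarith

lemma tendsto_bracket :
    Tendsto (fun N : ℕ => qbracket p L N * ((p : K) ^ N)⁻¹) atTop (𝓝 (L / (pExp L - 1))) := by
  have hLne : L ≠ 0 := norm_pos_iff.1 hL0
  have hp1 : (1 : ℝ) < p := by exact_mod_cast hp.out.one_lt
  have hq := exp_ne_one hiso hL0 hL1
  have hpn : ∀ N, (p : K) ^ N ≠ 0 := fun N => pow_ne_zero _ (p_ne hiso)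
  have h1 : Tendsto (fun N : ℕ => (pExp ((p : K) ^ N * L) - 1) * ((p : K) ^ N * L)⁻¹) atTop (𝓝 1) := by
    rw [tendsto_iff_norm_sub_tendsto_zero]
    have hz : Tendsto (fun N : ℕ => ((p : ℝ) ^ N)⁻¹ * ‖L‖ * (p : ℝ) ^ (1 / ((p : ℝ) - 1))) atTop (𝓝 0) := by
      have : Tendsto (fun N : ℕ => ((p : ℝ)⁻¹) ^ N) atTop (𝓝 0) :=
        tendsto_pow_atTop_nhds_zero_of_lt_one (by positivity) (inv_lt_one_of_one_lt₀ hp1)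
      simpa [inv_pow] using (this.mul_const ‖L‖).mul_const ((p : ℝ) ^ (1 / ((p : ℝ) - 1)))
    refine squeeze_zero (fun _ => norm_nonneg _) (fun N => ?_) hz
    have hx : ‖(p : K) ^ N * L‖ < (p : ℝ) ^ (-1 / ((p : ℝ) - 1)) := by
      rw [norm_mul]
      refine (mul_le_of_le_one_left (norm_nonneg _) ?_).trans_lt hL1
      rw [← emb_ppow (p := p)]; exact norm_emb_le hiso _
    have hb := exp_sub_bound hiso hx
    have hne : (p : K) ^ N * L ≠ 0 := mul_ne_zero (hpn N) hLne
    have hrw : (pExp ((p : K) ^ N * L) - 1) * ((p : K) ^ N * L)⁻¹ - 1 =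
      (pExp ((p : K) ^ N * L) - 1 - (p : K) ^ N * L) * ((p : K) ^ N * L)⁻¹ := by
      rw [sub_mul _ ((p : K) ^ N * L), mul_inv_cancel₀ hne]
    rw [hrw, norm_mul, norm_inv, ← norm_ppow hiso, ← norm_mul]
    rw [mul_inv_le_iff₀ (norm_pos_iff.2 hne)]
    linarith
  have h2 := h1.mul_const (L / (pExp L - 1))
  rw [one_mul] at h2
  refine h2.congr fun N => ?_
  rw [qbracket, qpow, emb_ppow]
  have hq' : 1 - pExp L ≠ 0 := fun h => hq (by linear_combination -h)
  have := hpn N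
  have e1 : pExp L - 1 = -(1 - pExp L) := by ring
  rw [e1]
  field_simp
  ring

lemma hasIq_iff (h : ℤ_[p] → K) (I : K)
    (hI : HasIq p L (fun x => h x * qpow L (-x)) I) :
    Tendsto (fun N : ℕ => ((p : K) ^ N)⁻¹ * ∑ x ∈ Finset.range (p ^ N), h (x : ℤ_[p]))
      atTop (𝓝 (L / (pExp L - 1) * I)) := by
  have hLne : L ≠ 0 := norm_pos_iff.1 hL0
  have hq := exp_ne_one hiso hL0 hL1
  have hb := tendsto_bracket hiso hL0 hL1
  have hne : ∀ᶠ N in atTop, qbracket p L N * ((p : K) ^ N)⁻¹ ≠ 0 :=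
    hb.eventually_ne (div_ne_zero hLne hq)
  refine (hb.mul hI).congr' ?_
  filter_upwards [hne] with N hN
  have hb0 : qbracket p L N ≠ 0 := left_ne_zero_of_mul hN
  have hs : ∀ x : ℕ, h (x : ℤ_[p]) * qpow L (-(x : ℤ_[p])) * qpow L (x : ℤ_[p]) = h x := by
    intro x; rw [mul_assoc, qpow_neg_mul hiso hL1, mul_one]
  simp only [hs]
  field_simp

end basics

open Filter Topology

lemma sum_range_mul_split {K : Type*} [AddCommMonoid K] (h : ℕ → K) (A B : ℕ) :
    ∑ x ∈ Finset.range (A * B), h x =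
      ∑ y ∈ Finset.range B, ∑ a ∈ Finset.range A, h (a + A * y) := by
  induction B with
  | zero => simp
  | succ B ih =>
    rw [Finset.sum_range_succ, ← ih, Nat.mul_succ, Finset.sum_range_add]
    congr 1
    exact Finset.sum_congr rfl fun a _ => by rw [add_comm]

section analysis
variable {p : ℕ} [hp : Fact p.Prime] {K : Type*} [NormedField K] [Algebra ℚ_[p] K]
variable (hiso : ∀ x : ℚ_[p], ‖algebraMap ℚ_[p] K x‖ = ‖x‖)

lemma max3 [IsUltrametricDist K] {a b : K} {e : ℝ} (ha : ‖a‖ ≤ e) (hb : ‖b‖ ≤ e) : ‖a + b‖ ≤ e :=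
  (IsUltrametricDist.norm_add_le_max a b).trans (max_le ha hb)

lemma max3' [IsUltrametricDist K] {a b : K} {e : ℝ} (ha : ‖a‖ ≤ e) (hb : ‖b‖ ≤ e) : ‖a - b‖ ≤ e := by
  rw [sub_eq_add_neg]; exact max3 ha (by rwa [norm_neg])

lemma usum [IsUltrametricDist K] {ι : Type*} {s : Finset ι} {f : ι → K} {e : ℝ} (he : 0 ≤ e)
    (h : ∀ i ∈ s, ‖f i‖ ≤ e) : ‖∑ i ∈ s, f i‖ ≤ e :=
  IsUltrametricDist.norm_sum_le_of_forall_le_of_nonneg he h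

lemma ev_small {δ : ℝ} (hδ : 0 < δ) : ∀ᶠ n : ℕ in atTop, ∀ t : ℤ_[p], ‖(p : ℤ_[p]) ^ n * t‖ ≤ δ := by
  have hp1 : (1 : ℝ) < p := by exact_mod_cast hp.out.one_lt
  have : Tendsto (fun N : ℕ => ((p : ℝ)⁻¹) ^ N) atTop (𝓝 0) :=
    tendsto_pow_atTop_nhds_zero_of_lt_one (by positivity) (inv_lt_one_of_one_lt₀ hp1)
  filter_upwards [this.eventually_le_const hδ] with n hn t
  rw [norm_mul, norm_Zppow, ← inv_pow]
  exact (mul_le_of_le_one_right (by positivity) (PadicInt.norm_le_one t)).trans hn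

lemma ev_smallP (hiso : ∀ x : ℚ_[p], ‖algebraMap ℚ_[p] K x‖ = ‖x‖) {δ : ℝ} (hδ : 0 < δ) :
    ∀ᶠ n : ℕ in atTop, ‖(p : K) ^ n‖ ≤ δ := by
  filter_upwards [ev_small (p := p) hδ] with n hn
  have := hn 1
  rwa [mul_one, ← norm_emb hiso, emb_ppow] at this

lemma ev_uc {h : ℤ_[p] → K} (hc : Continuous h) {ε : ℝ} (hε : 0 < ε) :
    ∀ᶠ n : ℕ in atTop, ∀ x t : ℤ_[p], ‖h (x + (p : ℤ_[p]) ^ n * t) - h x‖ ≤ ε := by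
  have huc := CompactSpace.uniformContinuous_of_continuous hc
  rw [Metric.uniformContinuous_iff] at huc
  obtain ⟨δ, hδ, h2⟩ := huc ε hε
  filter_upwards [ev_small (p := p) (half_pos hδ)] with n hn x t
  rw [← dist_eq_norm]
  refine (h2 ?_).le
  rw [dist_eq_norm, add_sub_cancel_left]
  exact (hn t).trans_lt (half_lt_self hδ)

lemma ev_bdd {h : ℤ_[p] → K} (hc : Continuous h) : ∃ B : ℝ, 1 ≤ B ∧ ∀ x, ‖h x‖ ≤ B := by
  obtain ⟨B, hB⟩ := isCompact_univ.exists_bound_of_continuousOn hc.continuousOn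
  exact ⟨max B 1, le_max_right _ _, fun x => (hB x trivial).trans (le_max_left _ _)⟩

variable {f f' : ℤ_[p] → K}

include hiso

lemma ud_raw (hf : IsUnifDiff f f') {ε : ℝ} (hε : 0 < ε) :
    ∃ δ > 0, ∀ x t : ℤ_[p], ‖t‖ ≤ δ → ‖f (x + t) - f x - emb t * f' x‖ ≤ ε * ‖t‖ := by
  obtain ⟨δ, hδ, h⟩ := hf ε hε
  refine ⟨δ, hδ, fun x t ht => ?_⟩
  by_cases h0 : t = 0
  · simp [h0, emb_zero]
  have htn : 0 < ‖t‖ := norm_pos_iff.2 h0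
  have := h (x + t) x (by simpa using htn) (by simpa using ht)
  rw [add_sub_cancel_left] at this
  have hne : (emb t : K) ≠ 0 := by rw [← norm_ne_zero_iff, norm_emb hiso]; exact htn.ne'
  have e : f (x + t) - f x - emb t * f' x = ((f (x + t) - f x) / emb t - f' x) * emb t := by
    field_simp
  rw [e, norm_mul, norm_emb hiso]
  gcongr

lemma ev_ud (hf : IsUnifDiff f f') {ε : ℝ} (hε : 0 < ε) :
    ∀ᶠ n : ℕ in atTop, ∀ x t : ℤ_[p],
      ‖f (x + (p : ℤ_[p]) ^ n * t) - f x - (p : K) ^ n * emb t * f' x‖ ≤ ε * ‖(p : K) ^ n‖ := by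
  obtain ⟨δ, hδ, h⟩ := ud_raw hiso hf hε
  filter_upwards [ev_small (p := p) hδ] with n hn x t
  have := h x _ (hn t)
  rw [emb_mul, emb_ppow] at this
  refine this.trans ?_
  rw [← norm_emb hiso, emb_mul, emb_ppow, norm_mul]
  gcongr
  exact mul_le_of_le_one_right (norm_nonneg _) (norm_emb_le hiso t)

lemma ud_cont (hf : IsUnifDiff f f') : Continuous f := by
  rw [Metric.continuous_iff]
  intro x ε hε
  obtain ⟨δ, hδ, h⟩ := ud_raw hiso hf one_pos
  have hB : 0 < 1 + ‖f' x‖ := by positivity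
  refine ⟨min δ (ε / (1 + ‖f' x‖)), by positivity, fun y hy => ?_⟩
  rw [dist_eq_norm] at hy ⊢
  have h1 := h x (y - x) (hy.le.trans (min_le_left _ _))
  rw [add_sub_cancel] at h1
  have h2 : ‖f y - f x‖ ≤ ‖y - x‖ + ‖y - x‖ * ‖f' x‖ := by
    have e : f y - f x = (f y - f x - emb (y - x) * f' x) + emb (y - x) * f' x := by ring
    rw [e]
    refine (norm_add_le _ _).trans ?_
    rw [norm_mul, norm_emb hiso]
    linarith
  have h3 := hy.trans_le (min_le_right _ _)
  rw [lt_div_iff₀ hB] at h3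
  linarith

variable [IsUltrametricDist K]

lemma ud_cont' (hf : IsUnifDiff f f') : Continuous f' := by
  rw [Metric.continuous_iff]
  intro x ε hε
  obtain ⟨δ, hδ, h⟩ := hf (ε / 2) (half_pos hε)
  refine ⟨δ, hδ, fun y hy => ?_⟩
  by_cases hxy : y = x
  · simpa [hxy] using hε
  rw [dist_eq_norm] at hy ⊢
  have hpos : 0 < ‖y - x‖ := norm_pos_iff.2 (sub_ne_zero.2 hxy)
  have h1 := h y x hpos hy.le
  have h2 := h x y (by rwa [norm_sub_rev]) (by rw [norm_sub_rev]; exact hy.le)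
  have e : (f x - f y) / emb (x - y) = (f y - f x) / (emb (y - x) : K) := by
    rw [emb_sub, emb_sub, ← neg_sub (f y), ← neg_sub (emb y : K), neg_div_neg_eq]
  rw [e] at h2
  have := max3' h1 h2
  rw [show ((f y - f x) / emb (y - x) - f' x - ((f y - f x) / emb (y - x) - f' y)) = f' y - f' x by ring]
    at this
  linarith

lemma volk_bound (r : ℕ → K) {ε : ℝ} (hε : 0 ≤ ε) (h0 : r 0 = 0)
    (hr : ∀ M x j : ℕ, ‖r (x + p ^ M * j) - r x‖ ≤ ε * ‖(p : K) ^ M‖) (M : ℕ) :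
    ‖((p : K) ^ M)⁻¹ * ∑ y ∈ Finset.range (p ^ M), r y‖ ≤ p * ε := by
  have hpK : (p : K) ≠ 0 := p_ne hiso
  have hpos : 0 ≤ (p : ℝ) * ε := by positivity
  induction M with
  | zero => simpa [h0] using hpos
  | succ M ih =>
    have e : ((p : K) ^ (M + 1))⁻¹ * ∑ y ∈ Finset.range (p ^ (M + 1)), r y =
        ((p : K) ^ M)⁻¹ * ∑ y ∈ Finset.range (p ^ M), r y +
        ((p : K) ^ (M + 1))⁻¹ * ∑ j ∈ Finset.range p, ∑ x ∈ Finset.range (p ^ M),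
          (r (x + p ^ M * j) - r x) := by
      rw [pow_succ p M, sum_range_mul_split]
      simp only [Finset.sum_sub_distrib, Finset.sum_const, Finset.card_range, nsmul_eq_mul]
      field_simp
      ring
    rw [e]
    refine max3 ih ?_
    rw [norm_mul, norm_inv]
    have h1 : ‖∑ j ∈ Finset.range p, ∑ x ∈ Finset.range (p ^ M), (r (x + p ^ M * j) - r x)‖
        ≤ ε * ‖(p : K) ^ M‖ :=
      usum (by positivity) fun j _ => usum (by positivity) fun x _ => hr M x j
    calc _ ≤ ‖(p : K) ^ (M + 1)‖⁻¹ * (ε * ‖(p : K) ^ M‖) := by gcongr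
      _ = p * ε := by
        rw [pow_succ, norm_mul, norm_p hiso]
        have : ‖(p : K) ^ M‖ ≠ 0 := norm_ne_zero_iff.2 (pow_ne_zero _ hpK)
        have : (p : ℝ) ≠ 0 := by exact_mod_cast hp.out.ne_zero
        field_simp

lemma volk_lim (hf : IsUnifDiff f f') {ε : ℝ} (hε : 0 < ε) :
    ∀ᶠ n : ℕ in atTop, ∀ (a : ℤ_[p]) (E : K),
      Tendsto (fun M : ℕ => ((p : K) ^ M)⁻¹ * ∑ y ∈ Finset.range (p ^ M), f (a + (p : ℤ_[p]) ^ n * y))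
        atTop (𝓝 E) → ‖E - f a + (p : K) ^ n * f' a * 2⁻¹‖ ≤ ε * ‖(p : K) ^ n‖ := by
  have hpK : (p : K) ≠ 0 := p_ne hiso
  have hp0 : (0 : ℝ) < p := by exact_mod_cast hp.out.pos
  have : CharZero K := charZ (p := p)
  have hε' : 0 < ε / p := by positivity
  obtain ⟨n1, hn1⟩ := eventually_atTop.1 (ev_ud hiso hf hε')
  filter_upwards [eventually_ge_atTop n1, ev_uc (ud_cont' hiso hf) hε'] with n hn huc a E hE
  set r : ℕ → K := fun y => f (a + (p : ℤ_[p]) ^ n * y) - f a - (p : K) ^ n * y * f' a with hr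
  have hb := volk_bound hiso r (ε := ε / p * ‖(p : K) ^ n‖) (by positivity) (by simp [hr]) (by
    intro M x j
    have h1 := hn1 (n + M) (by omega) (a + (p : ℤ_[p]) ^ n * x) j
    have h2 := huc a x
    have e : r (x + p ^ M * j) - r x =
        (f (a + (p : ℤ_[p]) ^ n * x + (p : ℤ_[p]) ^ (n + M) * j) - f (a + (p : ℤ_[p]) ^ n * x)
          - (p : K) ^ (n + M) * emb (j : ℤ_[p]) * f' (a + (p : ℤ_[p]) ^ n * x)) +
        (p : K) ^ (n + M) * (j : K) * (f' (a + (p : ℤ_[p]) ^ n * x) - f' a) := by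
      rw [emb_natCast]
      simp only [hr]
      push_cast
      rw [show a + (p : ℤ_[p]) ^ n * (x + (p : ℤ_[p]) ^ M * j) =
        a + (p : ℤ_[p]) ^ n * x + (p : ℤ_[p]) ^ (n + M) * j by ring]
      ring
    rw [e]
    have e2 : ε / p * ‖(p : K) ^ n‖ * ‖(p : K) ^ M‖ = ε / p * ‖(p : K) ^ (n + M)‖ := by
      rw [pow_add, norm_mul]; ring
    rw [e2]
    refine max3 h1 ?_
    rw [norm_mul, norm_mul, mul_comm]
    gcongr
    exact mul_le_of_le_one_right (norm_nonneg _) (norm_nat_le hiso j))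
  have hz : Tendsto (fun M : ℕ => (p : K) ^ M) atTop (𝓝 0) := by
    apply tendsto_pow_atTop_nhds_zero_of_norm_lt_one
    rw [norm_p hiso]
    exact inv_lt_one_of_one_lt₀ (by exact_mod_cast hp.out.one_lt)
  have hlim : Tendsto (fun M : ℕ => ((p : K) ^ M)⁻¹ * ∑ y ∈ Finset.range (p ^ M), r y) atTop
      (𝓝 (E - f a - (p : K) ^ n * f' a * ((0 - 1) * 2⁻¹))) := by
    refine ((hE.sub_const (f a)).sub (((hz.sub_const 1).mul_const 2⁻¹).const_mul
      ((p : K) ^ n * f' a))).congr fun M => ?_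
    have hsum : ∑ y ∈ Finset.range (p ^ M), (y : K) = (p : K) ^ M * ((p : K) ^ M - 1) * 2⁻¹ := by
      rw [eq_mul_inv_iff_mul_eq₀ two_ne_zero]
      have := Finset.sum_range_id_mul_two (p ^ M)
      have h1 : 1 ≤ p ^ M := Nat.one_le_pow _ _ hp.out.pos
      have h2 := congrArg (Nat.cast : ℕ → K) this
      push_cast [Nat.cast_sub h1] at h2
      exact h2
    simp only [hr, Finset.sum_sub_distrib, Finset.sum_const, Finset.card_range, nsmul_eq_mul]
    rw [← Finset.sum_mul, ← Finset.mul_sum, hsum]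
    push_cast
    field_simp
  have hle := le_of_tendsto hlim.norm (Eventually.of_forall hb)
  have e3 : E - f a - (p : K) ^ n * f' a * ((0 - 1) * 2⁻¹) = E - f a + (p : K) ^ n * f' a * 2⁻¹ := by ring
  rw [e3] at hle
  refine hle.trans (le_of_eq ?_)
  field_simp

lemma total_small {u v : ℤ_[p] → K} (hu : Continuous u) (hv : Continuous v) {ε : ℝ} (hε : 0 < ε) :
    ∀ᶠ n : ℕ in atTop, ∀ c d : ℤ_[p],
      ‖∑ a ∈ Finset.range (p ^ n), u (c + a) * v (d - a)‖ ≤ ε := by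
  obtain ⟨B, hB1, hB⟩ := ev_bdd hu
  obtain ⟨B', hB1', hB'⟩ := ev_bdd hv
  have hBp : 0 < B := by linarith
  have hBp' : 0 < B' := by linarith
  obtain ⟨n1, h1, h2⟩ := ((ev_uc hu (ε := ε / B') (by positivity)).and
    (ev_uc hv (ε := ε / B) (by positivity))).exists
  have hsm := ev_smallP (K := K) hiso (δ := ε / (B * B')) (by positivity)
  have hsm' : ∀ᶠ n : ℕ in atTop, ‖(p : K) ^ (n - n1)‖ ≤ ε / (B * B') :=
    (tendsto_sub_atTop_nat n1).eventually hsm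
  filter_upwards [eventually_ge_atTop n1, hsm'] with n hn hs c d
  obtain ⟨m, rfl⟩ := Nat.exists_eq_add_of_le hn
  rw [Nat.add_sub_cancel_left] at hs
  rw [pow_add, sum_range_mul_split, Finset.sum_comm]
  refine usum hε.le fun a _ => ?_
  have e : ∑ y ∈ Finset.range (p ^ m), u (c + ((a + p ^ n1 * y : ℕ) : ℤ_[p])) * v (d - ((a + p ^ n1 * y : ℕ) : ℤ_[p]))
      = (p : K) ^ m * (u (c + a) * v (d - a)) + ∑ y ∈ Finset.range (p ^ m),
        ((u (c + a + (p : ℤ_[p]) ^ n1 * y) - u (c + a)) * v (d - a + (p : ℤ_[p]) ^ n1 * (-y)) +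
          u (c + a) * (v (d - a + (p : ℤ_[p]) ^ n1 * (-y)) - v (d - a))) := by
    have : (p : K) ^ m * (u (c + a) * v (d - a)) =
      ∑ y ∈ Finset.range (p ^ m), u (c + a) * v (d - a) := by simp
    rw [this, ← Finset.sum_add_distrib]
    refine Finset.sum_congr rfl fun y _ => ?_
    push_cast
    rw [show c + ((a : ℤ_[p]) + (p : ℤ_[p]) ^ n1 * y) = c + a + (p : ℤ_[p]) ^ n1 * y by ring,
      show d - ((a : ℤ_[p]) + (p : ℤ_[p]) ^ n1 * y) = d - a + (p : ℤ_[p]) ^ n1 * (-y) by ring]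
    ring
  rw [e]
  refine max3 ?_ (usum hε.le fun y _ => max3 ?_ ?_)
  · rw [norm_mul, norm_mul]
    calc _ ≤ ε / (B * B') * (B * B') := by gcongr; exacts [hB _, hB' _]
      _ = ε := by field_simp
  · rw [norm_mul]
    calc _ ≤ ε / B' * B' := by gcongr; exacts [h1 _ _, hB' _]
      _ = ε := by field_simp
  · rw [norm_mul]
    calc _ ≤ B * (ε / B) := by gcongr; exacts [hB _, h2 _ _]
      _ = ε := by field_simp

end analysis

open Filter Topology

section fourier
variable {p : ℕ} [hp : Fact p.Prime] {K : Type*} [NormedField K]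

/-- finite Fourier sum -/
noncomputable def Efn (W : Finset K) (h : K → K) (a : ℤ) : K := ∑ w ∈ W, w ^ (-a) * h w

lemma appr_cong (n : ℕ) (z : ℤ_[p]) : ∃ t : ℤ_[p], z = (z.appr n : ℤ_[p]) + (p : ℤ_[p]) ^ n * t := by
  obtain ⟨t, ht⟩ := Ideal.mem_span_singleton.1 (PadicInt.appr_spec n z)
  exact ⟨t, by rw [← ht]; ring⟩

lemma nat_dvd_of_padic {n : ℕ} {a b : ℤ} {t : ℤ_[p]} (h : (a : ℤ_[p]) = b + (p : ℤ_[p]) ^ n * t) :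
    ((p : ℤ) ^ n) ∣ a - b := by
  have h1 : ((a - b : ℤ) : ℤ_[p]) ∈ Ideal.span {(p : ℤ_[p]) ^ n} := by
    rw [Ideal.mem_span_singleton]; exact ⟨t, by push_cast; rw [h]; ring⟩
  rw [← PadicInt.norm_le_pow_iff_mem_span_pow] at h1
  exact_mod_cast PadicInt.norm_int_le_pow_iff_dvd.1 h1

lemma zpow_cong {n : ℕ} {w : K} (hw : w ^ p ^ n = 1) {a b : ℤ} (h : ((p : ℤ) ^ n) ∣ a - b) :
    w ^ a = w ^ b := by
  have hw0 : w ≠ 0 := by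
    rintro rfl
    rw [zero_pow (pow_ne_zero _ hp.out.ne_zero)] at hw
    exact zero_ne_one hw
  obtain ⟨k, hk⟩ := h
  have : a = b + (p : ℤ) ^ n * k := by linarith
  rw [this, zpow_add₀ hw0, zpow_mul]
  have : w ^ ((p : ℤ) ^ n) = 1 := by exact_mod_cast hw
  rw [this, one_zpow, mul_one]

lemma phi_int {n : ℕ} {w : K} (hw : w ^ p ^ n = 1) (x : ℤ) : phi w n (x : ℤ_[p]) = w ^ x := by
  rw [phi]
  obtain ⟨t, ht⟩ := appr_cong n (x : ℤ_[p])
  rw [← zpow_natCast]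
  refine (zpow_cong hw (nat_dvd_of_padic (t := t) ?_)).symm
  exact_mod_cast ht

lemma phi_nat {n : ℕ} {w : K} (hw : w ^ p ^ n = 1) (x : ℕ) : phi w n (x : ℤ_[p]) = w ^ x := by
  have := phi_int hw (x : ℤ)
  exact_mod_cast this

lemma Efn_cong {n : ℕ} {W : Finset K} (hW : ∀ w ∈ W, w ^ p ^ n = 1) (h : K → K) {a b : ℤ}
    (hab : ((p : ℤ) ^ n) ∣ a - b) : Efn W h a = Efn W h b := by
  refine Finset.sum_congr rfl fun w hw => ?_
  rw [zpow_cong (hW w hw) (a := -a) (b := -b)]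
  rw [show -a - -b = -(a - b) by ring]
  exact hab.neg_right

lemma geom_zero {n : ℕ} {w : K} (hw : w ^ p ^ n = 1) (h1 : w ≠ 1) :
    ∑ a ∈ Finset.range (p ^ n), w ^ a = 0 := by
  rw [geom_sum_eq h1, hw, sub_self, zero_div]

lemma w_ne {n : ℕ} {w : K} (hw : w ^ p ^ n = 1) : w ≠ 0 := by
  rintro rfl
  rw [zero_pow (pow_ne_zero _ hp.out.ne_zero)] at hw
  exact zero_ne_one hw

lemma conv_fourier (hpK : (p : K) ≠ 0) {n : ℕ} {W : Finset K} (hW : ∀ w ∈ W, w ^ p ^ n = 1)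
    (F G : K → K) (z : ℤ) :
    ∑ w ∈ W, F w * G w * w ^ (-z) =
      ((p : K) ^ n)⁻¹ * ∑ a ∈ Finset.range (p ^ n), Efn W F a * Efn W G (z - a) := by
  rw [eq_inv_mul_iff_mul_eq₀ (pow_ne_zero _ hpK)]
  have : ∑ a ∈ Finset.range (p ^ n), Efn W F a * Efn W G (z - a) =
      ∑ w ∈ W, ∑ v ∈ W, F w * G v * v ^ (-z) * ∑ a ∈ Finset.range (p ^ n), (v / w) ^ a := by
    simp only [Efn, Finset.sum_mul_sum]
    simp only [Finset.mul_sum]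
    rw [Finset.sum_comm]
    refine Finset.sum_congr rfl fun w hw => ?_
    rw [Finset.sum_comm]
    refine Finset.sum_congr rfl fun v hv => ?_
    refine Finset.sum_congr rfl fun a _ => ?_
    have hv0 := w_ne (hW v hv)
    have hw0 := w_ne (hW w hw)
    rw [show -(z - (a : ℤ)) = -z + a by ring, zpow_add₀ hv0, zpow_neg w, zpow_natCast, zpow_natCast,
      div_pow]
    field_simp
  rw [this, Finset.mul_sum]
  refine Finset.sum_congr rfl fun w hw => ?_
  have hw0 := w_ne (hW w hw)
  rw [Finset.sum_eq_single_of_mem w hw]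
  · rw [div_self hw0]; simp; ring
  · intro v hv hne
    rw [geom_zero, mul_zero]
    · rw [div_pow, hW v hv, hW w hw, div_one]
    · intro h; exact hne ((div_eq_one_iff_eq hw0).1 h)

variable {C : ℕ → Finset K} (hC : ∀ n : ℕ, ∀ w : K, w ∈ C n ↔ w ^ p ^ n = 1)
    (hCcard : ∀ n : ℕ, (C n).card = p ^ n)
include hC

lemma C_mono (n : ℕ) : C n ⊆ C (n + 1) := by
  intro w hw
  rw [hC] at hw ⊢
  rw [pow_succ, pow_mul, hw, one_pow]

include hCcard

lemma orth (n : ℕ) (j : ℤ) :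
    ∑ w ∈ C n, w ^ j = if ((p : ℤ) ^ n) ∣ j then (p : K) ^ n else 0 := by
  split_ifs with h
  · rw [Finset.sum_congr rfl (g := fun _ => (1 : K)), Finset.sum_const, hCcard]
    · simp
    · intro w hw
      have := zpow_cong ((hC n w).1 hw) (a := j) (b := 0) (by simpa using h)
      simpa using this
  · have hex : ∃ v ∈ C n, v ^ j ≠ 1 := by
      by_contra! hall
      have hg : Int.gcd j ((p : ℤ) ^ n) ∣ p ^ n := by
        have := Int.gcd_dvd_right j ((p : ℤ) ^ n)
        exact_mod_cast this
      obtain ⟨k, hk, hk2⟩ := (Nat.dvd_prime_pow hp.out).1 hg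
      have hkn : k < n := by
        refine lt_of_le_of_ne hk fun hkn => h ?_
        have := Int.gcd_dvd_left j ((p : ℤ) ^ n)
        rw [hk2, hkn] at this
        exact_mod_cast this
      have hsub : C n ⊆ C k := by
        intro v hv
        rw [hC]
        have h1 := hall v hv
        have h2 : v ^ ((p : ℤ) ^ n) = 1 := by exact_mod_cast (hC n v).1 hv
        have hv0 := w_ne ((hC n v).1 hv)
        have hb := Int.gcd_eq_gcd_ab j ((p : ℤ) ^ n)
        rw [hk2] at hb
        have : v ^ ((p ^ k : ℕ) : ℤ) = 1 := by
          rw [hb, zpow_add₀ hv0, zpow_mul, zpow_mul, h1, h2, one_zpow, one_zpow, mul_one]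
        exact_mod_cast this
      have := Finset.card_le_card hsub
      rw [hCcard, hCcard] at this
      exact absurd this (not_le.2 (Nat.pow_lt_pow_right hp.out.one_lt hkn))
    obtain ⟨v, hv, hvj⟩ := hex
    have hv1 := (hC n v).1 hv
    have hv0 := w_ne hv1
    have hs : ∑ w ∈ C n, w ^ j = v ^ j * ∑ w ∈ C n, w ^ j := by
      rw [Finset.mul_sum]
      symm
      refine Finset.sum_bij (fun w _ => v * w) ?_ ?_ ?_ ?_
      · intro w hw; rw [hC] at hw ⊢; rw [mul_pow, hv1, hw, one_mul]
      · intro a _ b _ hab; exact mul_left_cancel₀ hv0 hab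
      · intro b hb; refine ⟨v⁻¹ * b, ?_, by field_simp⟩
        rw [hC] at hb ⊢; rw [mul_pow, inv_pow, hv1, hb]; simp
      · intro w _; rw [mul_zpow]
    have : (v ^ j - 1) * ∑ w ∈ C n, w ^ j = 0 := by linear_combination -hs
    exact (mul_eq_zero.1 this).resolve_left (sub_ne_zero.2 hvj)

lemma Efn_lim (hpK : (p : K) ≠ 0) {f : ℤ_[p] → K} {fh : K → K} (n : ℕ)
    (hfh : ∀ w : K, w ^ p ^ n = 1 →
      Tendsto (fun N : ℕ => ((p : K) ^ N)⁻¹ * ∑ x ∈ Finset.range (p ^ N), phi w n (x : ℤ_[p]) * f x)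
      atTop (𝓝 (fh w))) (a : ℕ) (ha : a < p ^ n) :
    Tendsto (fun M : ℕ => ((p : K) ^ M)⁻¹ * ∑ y ∈ Finset.range (p ^ M),
      f ((a : ℤ_[p]) + (p : ℤ_[p]) ^ n * y)) atTop (𝓝 (Efn (C n) fh a)) := by
  have h1 : Tendsto (fun N : ℕ => ∑ w ∈ C n, w ^ (-(a : ℤ)) *
      (((p : K) ^ N)⁻¹ * ∑ x ∈ Finset.range (p ^ N), phi w n (x : ℤ_[p]) * f x)) atTop
      (𝓝 (Efn (C n) fh a)) :=
    tendsto_finsetSum _ fun w hw => (hfh w ((hC n w).1 hw)).const_mul _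
  have h2 := (tendsto_add_atTop_iff_nat n).2 h1
  refine h2.congr fun M => ?_
  have e1 : ∑ w ∈ C n, w ^ (-(a : ℤ)) *
      (((p : K) ^ (M + n))⁻¹ * ∑ x ∈ Finset.range (p ^ (M + n)), phi w n (x : ℤ_[p]) * f x) =
      ((p : K) ^ (M + n))⁻¹ * ∑ x ∈ Finset.range (p ^ (M + n)),
        (∑ w ∈ C n, w ^ ((x : ℤ) - a)) * f x := by
    simp only [Finset.mul_sum, Finset.sum_mul]
    rw [Finset.sum_comm]
    refine Finset.sum_congr rfl fun x _ => Finset.sum_congr rfl fun w hw => ?_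
    have hw1 := (hC n w).1 hw
    rw [phi_nat hw1, sub_eq_add_neg, zpow_add₀ (w_ne hw1), zpow_natCast]
    ring
  rw [e1, add_comm M n, pow_add p n M, sum_range_mul_split]
  simp only [orth hC hCcard]
  have e2 : ∀ y ∈ Finset.range (p ^ M), ∑ b ∈ Finset.range (p ^ n),
      (if (p : ℤ) ^ n ∣ ((b + p ^ n * y : ℕ) : ℤ) - a then (p : K) ^ n else 0) *
        f ((b + p ^ n * y : ℕ) : ℤ_[p]) = (p : K) ^ n * f ((a : ℤ_[p]) + (p : ℤ_[p]) ^ n * y) := by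
    intro y _
    rw [Finset.sum_eq_single_of_mem a (Finset.mem_range.2 ha)]
    · rw [if_pos]
      · push_cast; rfl
      · push_cast; exact ⟨y, by ring⟩
    · intro b hb hne
      rw [if_neg, zero_mul]
      intro hd
      apply hne
      rw [Finset.mem_range] at hb
      have hd2 : (p : ℤ) ^ n ∣ (b : ℤ) - a := by
        have : (b : ℤ) - a = (((b + p ^ n * y : ℕ) : ℤ) - a) - (p : ℤ) ^ n * y := by push_cast; ring
        rw [this]; exact dvd_sub hd (dvd_mul_right _ _)
      have := Int.eq_zero_of_abs_lt_dvd hd2 (by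
        have h1 : (b : ℤ) < (p : ℤ) ^ n := by exact_mod_cast hb
        have h2 : (a : ℤ) < (p : ℤ) ^ n := by exact_mod_cast ha
        rw [abs_lt]; constructor <;> linarith [Int.natCast_nonneg a, Int.natCast_nonneg b])
      omega
  rw [Finset.sum_congr rfl e2, ← Finset.mul_sum, pow_add]
  field_simp

end fourier

open Filter Topology

section main
variable {p : ℕ} [hp : Fact p.Prime] {K : Type*} [NormedField K] [Algebra ℚ_[p] K]
  [IsUltrametricDist K]

def HFC (p : ℕ) [Fact p.Prime] {K : Type*} [NormedField K] (f : ℤ_[p] → K) (fh : K → K) : Prop :=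
  ∀ (n : ℕ) (w : K), w ^ p ^ n = 1 →
      Tendsto (fun N : ℕ => ((p : K) ^ N)⁻¹ * ∑ x ∈ Finset.range (p ^ N), phi w n (x : ℤ_[p]) * f x)
      atTop (𝓝 (fh w))

/-- the finite convolution sum -/
noncomputable def Ufn (f g' : ℤ_[p] → K) (z : ℕ) : K :=
  ∑ a ∈ Finset.range (z + 1), f (a : ℤ_[p]) * g' ((z : ℤ_[p]) - a)

omit [Algebra ℚ_[p] K] [IsUltrametricDist K] in
lemma factor {P X : K} (hP : P ≠ 0) {ε : ℝ} (h : ‖X‖ ≤ ε * ‖P‖) : ∃ α : K, ‖α‖ ≤ ε ∧ X = P * α := by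
  refine ⟨P⁻¹ * X, ?_, by field_simp⟩
  rw [norm_mul, norm_inv, inv_mul_le_iff₀ (norm_pos_iff.2 hP)]
  linarith

omit [Algebra ℚ_[p] K] [IsUltrametricDist K] in
lemma nmul {a b : K} {A B : ℝ} (hA : 0 ≤ A) (ha : ‖a‖ ≤ A) (hb : ‖b‖ ≤ B) : ‖a * b‖ ≤ A * B := by
  rw [norm_mul]; gcongr

variable (hiso : ∀ x : ℚ_[p], ‖algebraMap ℚ_[p] K x‖ = ‖x‖)
  {C : ℕ → Finset K} (hC : ∀ n : ℕ, ∀ w : K, w ∈ C n ↔ w ^ p ^ n = 1)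
    (hCcard : ∀ n : ℕ, (C n).card = p ^ n)
  {f f' g g' : ℤ_[p] → K} {fh gh : K → K}

include hiso hC hCcard

lemma Eb (hf : IsUnifDiff f f') (hfh : HFC p f fh) {ε : ℝ} (hε : 0 < ε) :
    ∀ᶠ n : ℕ in atTop, ∀ a : ℕ, a < p ^ n →
      ‖Efn (C n) fh a - f a + (p : K) ^ n * f' a * 2⁻¹‖ ≤ ε * ‖(p : K) ^ n‖ := by
  filter_upwards [volk_lim hiso hf hε] with n hn a ha
  exact hn a _ (Efn_lim hC hCcard (p_ne hiso) n (hfh n) a ha)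

lemma conv_est (hf : IsUnifDiff f f') (hg : IsUnifDiff g g') (hfh : HFC p f fh) (hgh : HFC p g gh)
    (z : ℤ_[p]) :
    Tendsto (fun n : ℕ => (∑ w ∈ C n, fh w * gh w * phi w⁻¹ n z) -
      ((p : K) ^ n)⁻¹ * ∑ a ∈ Finset.range (p ^ n), f (a : ℤ_[p]) * g (z - a) +
      Ufn f g' (z.appr n)) atTop (𝓝 0) := by
  have hpK : (p : K) ≠ 0 := p_ne hiso
  obtain ⟨B1, hB1, hb1⟩ := ev_bdd (ud_cont hiso hf)
  obtain ⟨B2, hB2, hb2⟩ := ev_bdd (ud_cont' hiso hf)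
  obtain ⟨B3, hB3, hb3⟩ := ev_bdd (ud_cont hiso hg)
  obtain ⟨B4, hB4, hb4⟩ := ev_bdd (ud_cont' hiso hg)
  obtain ⟨B, hB, bf, bf', bg, bg'⟩ : ∃ B : ℝ, 1 ≤ B ∧ (∀ x, ‖f x‖ ≤ B) ∧ (∀ x, ‖f' x‖ ≤ B) ∧
      (∀ x, ‖g x‖ ≤ B) ∧ (∀ x, ‖g' x‖ ≤ B) :=
    ⟨B1 + B2 + B3 + B4, by linarith, fun x => by linarith [hb1 x], fun x => by linarith [hb2 x],
      fun x => by linarith [hb3 x], fun x => by linarith [hb4 x]⟩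
  rw [Metric.tendsto_nhds]
  intro η hη
  obtain ⟨ε, hε, hε1, hεη⟩ : ∃ ε : ℝ, 0 < ε ∧ ε ≤ 1 ∧ 4 * B ^ 2 * ε < η := by
    refine ⟨min 1 (η / (8 * B ^ 2)), by positivity, min_le_left _ _, ?_⟩
    calc 4 * B ^ 2 * min 1 (η / (8 * B ^ 2)) ≤ 4 * B ^ 2 * (η / (8 * B ^ 2)) := by
          gcongr; exact min_le_right _ _
      _ = η / 2 := by field_simp; norm_num
      _ < η := by linarith
  have hBε : B * ε ≤ B ^ 2 * ε := by gcongr; nlinarith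
  have hεB : ε ≤ B * ε := by nlinarith
  have hhalf := norm_half_le (K := K) hiso
  filter_upwards [Eb hiso hC hCcard hf hfh hε, Eb hiso hC hCcard hg hgh hε,
    ev_ud hiso hg hε, ev_uc (ud_cont' hiso hg) hε, ev_smallP (K := K) hiso hε,
    total_small hiso (ud_cont hiso hf) (ud_cont' hiso hg) hε,
    total_small hiso (ud_cont' hiso hf) (ud_cont hiso hg) hε] with n hEf hEg hud huc hPn ht1 ht2
  have hPn0 : (p : K) ^ n ≠ 0 := pow_ne_zero _ hpK
  obtain ⟨t, ht⟩ := appr_cong n z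
  set zn := z.appr n with hzn
  have hznlt : zn < p ^ n := PadicInt.appr_lt z n
  have hS : ∑ w ∈ C n, fh w * gh w * phi w⁻¹ n z = ((p : K) ^ n)⁻¹ *
      ∑ a ∈ Finset.range (p ^ n), Efn (C n) fh a * Efn (C n) gh ((zn : ℤ) - a) := by
    rw [← conv_fourier hpK (fun w hw => (hC n w).1 hw)]
    refine Finset.sum_congr rfl fun w _ => ?_
    rw [phi, zpow_neg, zpow_natCast, inv_pow]
  -- pointwise estimate
  have hpt : ∀ a ∈ Finset.range (p ^ n), ∃ e : K, ‖e‖ ≤ 4 * B ^ 2 * ε ∧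
      ((p : K) ^ n)⁻¹ * (Efn (C n) fh a * Efn (C n) gh ((zn : ℤ) - a)) =
      ((p : K) ^ n)⁻¹ * (f (a : ℤ_[p]) * g (z - a)) + e +
      (((if a < zn + 1 then 0 else 1) - emb t) * (f a * g' (z - a)) - 2⁻¹ * (f a * g' (z - a)) -
        2⁻¹ * (f' a * g (z - a))) := by
    intro a ha
    rw [Finset.mem_range] at ha
    obtain ⟨b, sN, hblt, hbz, hbp, hsN⟩ : ∃ (b : ℕ) (s : ℤ_[p]), b < p ^ n ∧
        Efn (C n) gh ((zn : ℤ) - a) = Efn (C n) gh b ∧ (b : ℤ_[p]) = z - a + (p : ℤ_[p]) ^ n * s ∧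
        (emb s : K) = (if a < zn + 1 then 0 else 1) - emb t := by
      by_cases h : a < zn + 1
      · refine ⟨zn - a, -t, by omega, ?_, ?_, by simp [h, emb_neg]⟩
        · congr 1; omega
        · rw [Nat.cast_sub (by omega)]; linear_combination -ht
      · refine ⟨zn + p ^ n - a, 1 - t, by omega, ?_, ?_, by simp [h, emb_sub, emb_one]⟩
        · apply Efn_cong (n := n) (fun w hw => (hC n w).1 hw)
          refine ⟨-1, ?_⟩
          rw [Nat.cast_sub (by omega)]; push_cast; ring
        · rw [Nat.cast_sub (by omega)]; push_cast; linear_combination -ht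
    obtain ⟨α, hα, eα⟩ := factor hPn0 (hEf a ha)
    obtain ⟨β, hβ, eβ⟩ := factor hPn0 (hEg b hblt)
    obtain ⟨γ, hγ, eγ⟩ := factor hPn0 (hud (z - a) sN)
    have hκ := huc (z - a) sN
    rw [← hbp] at eγ hκ
    obtain ⟨κ, eκ⟩ : ∃ κ : K, κ = g' b - g' (z - a) := ⟨_, rfl⟩
    rw [← eκ] at hκ
    have hs1 : ‖(emb sN : K)‖ ≤ 1 := norm_emb_le hiso _
    obtain ⟨e1, he1⟩ : ∃ e1 : K, e1 = -(2⁻¹ * f' a) + α := ⟨_, rfl⟩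
    obtain ⟨e2, he2⟩ : ∃ e2 : K, e2 = emb sN * g' (z - a) + (γ - 2⁻¹ * g' b + β) := ⟨_, rfl⟩
    have hE : Efn (C n) fh a = f a + (p : K) ^ n * e1 := by rw [he1]; linear_combination eα
    have hG : Efn (C n) gh b = g (z - a) + (p : K) ^ n * e2 := by
      rw [he2]; linear_combination eβ + eγ
    have ne1 : ‖e1‖ ≤ 2 * B := by
      rw [he1]
      refine max3 ?_ (by linarith)
      rw [norm_neg]; exact nmul (by norm_num) hhalf (bf' _)
    have ne2 : ‖e2‖ ≤ 2 * B := by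
      rw [he2]
      refine max3 ((nmul zero_le_one hs1 (bg' _)).trans (by linarith)) (max3 (max3' (by linarith) ?_)
        (by linarith))
      exact nmul (by norm_num) hhalf (bg' _)
    refine ⟨f a * (γ - 2⁻¹ * κ + β) + α * g (z - a) + (p : K) ^ n * (e1 * e2), ?_, ?_⟩
    · refine max3 (max3 ?_ ?_) ?_
      · refine (nmul (B := 2 * ε) (by linarith) (bf _) (max3 (max3' (by linarith) ?_) (by linarith))).trans
          (by linarith)
        exact nmul (by norm_num) hhalf hκ
      · exact (nmul hε.le hα (bg _)).trans (by nlinarith)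
      · exact (nmul hε.le hPn (nmul (by linarith) ne1 ne2)).trans (by nlinarith)
    · rw [hbz, hE, hG, ← hsN]
      have e2' : e2 = emb sN * g' (z - a) + (γ - 2⁻¹ * (g' (z - a) + κ) + β) := by
        rw [he2, eκ]; ring
      have : ((p : K) ^ n)⁻¹ * ((f a + (p : K) ^ n * e1) * (g (z - a) + (p : K) ^ n * e2)) =
        ((p : K) ^ n)⁻¹ * (f a * g (z - a)) + f a * e2 + e1 * g (z - a) + (p : K) ^ n * (e1 * e2) := by
        field_simp; ring
      rw [this]
      linear_combination f a * e2' + g (z - a) * he1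
  choose! e he hpe using hpt
  have hU : Ufn f g' zn = ∑ a ∈ Finset.range (p ^ n), (if a < zn + 1 then 1 else 0) *
      (f (a : ℤ_[p]) * g' ((zn : ℤ_[p]) - a)) := by
    rw [Ufn]
    simp only [ite_mul, one_mul, zero_mul]
    rw [← Finset.sum_filter]
    congr 1
    ext a; simp only [Finset.mem_range, Finset.mem_filter]; omega
  rw [dist_zero_right, hS, hU, Finset.mul_sum, Finset.mul_sum, Finset.sum_congr rfl hpe]
  refine lt_of_le_of_lt ?_ hεη
  have hfin : ∑ a ∈ Finset.range (p ^ n), (((p : K) ^ n)⁻¹ * (f (a : ℤ_[p]) * g (z - a)) + e a +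
      (((if a < zn + 1 then 0 else 1) - emb t) * (f a * g' (z - a)) - 2⁻¹ * (f a * g' (z - a)) -
        2⁻¹ * (f' a * g (z - a)))) - ∑ a ∈ Finset.range (p ^ n), ((p : K) ^ n)⁻¹ * (f (a : ℤ_[p]) * g (z - a))
      + ∑ a ∈ Finset.range (p ^ n), (if a < zn + 1 then 1 else 0) *
      (f (a : ℤ_[p]) * g' ((zn : ℤ_[p]) - a)) = ∑ a ∈ Finset.range (p ^ n), e a +
      ((emb (1 - t) - 2⁻¹) * ∑ a ∈ Finset.range (p ^ n), f (0 + a) * g' (z - a) -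
        2⁻¹ * ∑ a ∈ Finset.range (p ^ n), f' (0 + a) * g (z - a) +
       ∑ a ∈ Finset.range (p ^ n), (if a < zn + 1 then 1 else 0) *
      (f (a : ℤ_[p]) * (g' ((zn : ℤ_[p]) - a) - g' (z - a)))) := by
    simp only [Finset.mul_sum, ← Finset.sum_sub_distrib, ← Finset.sum_add_distrib]
    refine Finset.sum_congr rfl fun a _ => ?_
    rw [emb_sub, emb_one, zero_add]
    split_ifs <;> ring
  rw [hfin]
  have h1 : ‖(emb (1 - t) : K) - 2⁻¹‖ ≤ 2 :=
    max3' ((norm_emb_le hiso _).trans (by norm_num)) hhalf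
  have h4 : 0 ≤ 4 * B ^ 2 * ε := by positivity
  refine max3 (usum h4 he) (max3 (max3' ?_ ?_) (usum h4 fun a _ => ?_))
  · exact (nmul (by norm_num) h1 (ht1 0 z)).trans (by linarith)
  · exact (nmul (by norm_num) hhalf (ht2 0 z)).trans (by linarith)
  · have h5 := huc (zn - a) t
    rw [show (zn : ℤ_[p]) - a + (p : ℤ_[p]) ^ n * t = z - a by linear_combination -ht, norm_sub_rev] at h5
    split_ifs
    · rw [one_mul]; exact (nmul (by linarith) (bf _) h5).trans (by linarith)
    · rw [zero_mul, norm_zero]; exact h4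

end main

open Filter Topology

section main2
variable {p : ℕ} [hp : Fact p.Prime] {K : Type*} [NormedField K] [Algebra ℚ_[p] K]
  [IsUltrametricDist K]

/-- the constant `(p-1)/2` -/
noncomputable def cst (p : ℕ) (K : Type*) [NormedField K] : K := ((p : K) - 1) * 2⁻¹

/-- the digit correlation sum -/
noncomputable def Sfn (p : ℕ) (K : Type*) [NormedField K] (k : ℤ) : K :=
  ∑ i ∈ Finset.range p, ((i : K) - cst p K) * ((((k - i) % p : ℤ) : K) - cst p K)

variable (hiso : ∀ x : ℚ_[p], ‖algebraMap ℚ_[p] K x‖ = ‖x‖)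
  {C : ℕ → Finset K} (hC : ∀ n : ℕ, ∀ w : K, w ∈ C n ↔ w ^ p ^ n = 1)
    (hCcard : ∀ n : ℕ, (C n).card = p ^ n)
  {F f f' g g' : ℤ_[p] → K} {Fh gh : K → K}

include hiso

lemma cst_le : ‖cst p K‖ ≤ 2 := by
  have h : ‖(p : K) - 1‖ ≤ 1 := max3' (norm_nat_le hiso p) (by simp)
  exact (nmul zero_le_one h (norm_half_le hiso)).trans (by norm_num)

lemma dig_le (i : ℤ) : ‖(i : K) - cst p K‖ ≤ 2 :=
  max3' ((norm_int_le hiso i).trans (by norm_num)) (cst_le hiso)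

lemma dig_le' (i : ℕ) : ‖(i : K) - cst p K‖ ≤ 2 :=
  max3' ((norm_nat_le hiso i).trans (by norm_num)) (cst_le hiso)

lemma S_le (k : ℤ) : ‖Sfn p K k‖ ≤ 4 :=
  usum (by norm_num) fun i _ => (nmul (by norm_num) (dig_le' hiso i) (dig_le hiso _)).trans (by norm_num)

lemma sum_dig : ∑ i ∈ Finset.range p, ((i : K) - cst p K) = 0 := by
  have : CharZero K := charZ (p := p)
  have hsum : ∑ y ∈ Finset.range p, (y : K) = (p : K) * ((p : K) - 1) * 2⁻¹ := by
    rw [eq_mul_inv_iff_mul_eq₀ two_ne_zero]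
    have h2 := congrArg (Nat.cast : ℕ → K) (Finset.sum_range_id_mul_two p)
    push_cast [Nat.cast_sub hp.out.one_lt.le] at h2
    exact h2
  rw [Finset.sum_sub_distrib, hsum, cst]
  simp only [Finset.sum_const, Finset.card_range, nsmul_eq_mul]
  ring

lemma S_diff (k : ℕ) (hk : k < p) :
    Sfn p K k - Sfn p K ((k : ℤ) - 1) = -(p : K) * ((k : K) - cst p K) := by
  have h1 : ∀ i ∈ Finset.range p, ((i : K) - cst p K) * (((((k : ℤ) - i) % p : ℤ) : K) - cst p K) -
      ((i : K) - cst p K) * (((((k : ℤ) - 1 - i) % p : ℤ) : K) - cst p K) =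
      ((i : K) - cst p K) - (if i = k then (p : K) * ((i : K) - cst p K) else 0) := by
    intro i hi
    rw [Finset.mem_range] at hi
    have h2 : ((k : ℤ) - i) % p - ((k : ℤ) - 1 - i) % p = 1 - (if i = k then (p : ℤ) else 0) := by
      have a1 : ((k : ℤ) - i) % p = if i ≤ k then (k : ℤ) - i else k - i + p := by
        split_ifs with h
        · exact Int.emod_eq_of_lt (by omega) (by omega)
        · rw [← Int.add_emod_right]; exact Int.emod_eq_of_lt (by omega) (by omega)
      have a2 : ((k : ℤ) - 1 - i) % p = if i < k then (k : ℤ) - 1 - i else k - 1 - i + p := by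
        split_ifs with h
        · exact Int.emod_eq_of_lt (by omega) (by omega)
        · rw [← Int.add_emod_right]; exact Int.emod_eq_of_lt (by omega) (by omega)
      rw [a1, a2]
      split_ifs <;> omega
    have h3 := congrArg (Int.cast : ℤ → K) h2
    split_ifs at h3 ⊢ with hik
    · push_cast at h3
      linear_combination ((i : K) - cst p K) * h3
    · push_cast at h3
      linear_combination ((i : K) - cst p K) * h3
  rw [Sfn, Sfn, ← Finset.sum_sub_distrib, Finset.sum_congr rfl h1, Finset.sum_sub_distrib,
    sum_dig hiso, Finset.sum_ite_eq' (Finset.range p) k, if_pos (Finset.mem_range.2 hk)]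
  ring

include hC hCcard

open Classical in
lemma e_est (hF : IsUnifDiff F f) (hFh : HFC p F Fh) {η : ℝ} (hη : 0 < η) :
    ∀ᶠ n : ℕ in atTop, ∀ a i : ℕ, a < p ^ n → i < p →
      ‖Efn (C (n + 1) \ C n) Fh (a + (p : ℤ) ^ n * i) - (p : K) ^ n * (f a * ((i : K) - cst p K))‖
        ≤ η * ‖(p : K) ^ n‖ := by
  obtain ⟨ε, hε, rfl⟩ : ∃ ε : ℝ, 0 < ε ∧ η = 2 * ε := ⟨η / 2, by positivity, by ring⟩
  have h1 := Eb hiso hC hCcard hF hFh hε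
  filter_upwards [h1, (tendsto_add_atTop_nat 1).eventually h1, ev_ud hiso hF hε,
    ev_uc (ud_cont' hiso hF) hε] with n hn hn1 hud huc a i ha hi
  have hlt : a + p ^ n * i < p ^ (n + 1) := by
    rw [pow_succ]
    calc a + p ^ n * i < p ^ n + p ^ n * i := by omega
      _ = p ^ n * (i + 1) := by ring
      _ ≤ p ^ n * p := Nat.mul_le_mul_left _ hi
  have t1 := hn1 (a + p ^ n * i) hlt
  have t2 := hn a ha
  have t3 := hud a i
  have t4 := huc a i
  have e0 : Efn (C (n + 1) \ C n) Fh (a + (p : ℤ) ^ n * i) =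
      Efn (C (n + 1)) Fh (((a + p ^ n * i : ℕ)) : ℤ) - Efn (C n) Fh a := by
    have : Efn (C n) Fh (a : ℤ) = Efn (C n) Fh (a + (p : ℤ) ^ n * i) :=
      Efn_cong (n := n) (fun w hw => (hC n w).1 hw) _ ⟨-i, by ring⟩
    rw [this]
    push_cast
    simp only [Efn]
    rw [← Finset.sum_sdiff (C_mono hC n)]
    ring
  have hP1 : ‖(p : K) ^ (n + 1)‖ ≤ ‖(p : K) ^ n‖ := by
    rw [pow_succ, norm_mul]
    exact mul_le_of_le_one_right (norm_nonneg _) (norm_nat_le hiso p)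
  push_cast at t1
  rw [emb_natCast] at t3
  have e1 : Efn (C (n + 1) \ C n) Fh (a + (p : ℤ) ^ n * i) - (p : K) ^ n * (f a * ((i : K) - cst p K)) =
      (Efn (C (n + 1)) Fh ((a : ℤ) + (p : ℤ) ^ n * i) - F (a + (p : ℤ_[p]) ^ n * i) +
        (p : K) ^ (n + 1) * f (a + (p : ℤ_[p]) ^ n * i) * 2⁻¹)
      - (Efn (C n) Fh a - F a + (p : K) ^ n * f a * 2⁻¹)
      + (F (a + (p : ℤ_[p]) ^ n * i) - F a - (p : K) ^ n * (i : K) * f a)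
      - (p : K) ^ (n + 1) * ((f (a + (p : ℤ_[p]) ^ n * i) - f a) * 2⁻¹) := by
    rw [e0, cst]; push_cast; ring
  have hPn := norm_nonneg ((p : K) ^ n)
  rw [e1]
  refine max3' (max3 (max3' ?_ ?_) ?_) ?_
  · refine t1.trans ?_
    nlinarith
  · exact t2.trans (by nlinarith)
  · exact t3.trans (by nlinarith)
  · refine (nmul hPn hP1 (nmul hε.le t4 (norm_half_le hiso))).trans (by nlinarith)

open Classical in
lemma D_est (hF : IsUnifDiff F f) (hf : IsUnifDiff f f') (hg : IsUnifDiff g g')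
    (hFh : HFC p F Fh) (hgh : HFC p g gh) {η : ℝ} (hη : 0 < η) :
    ∀ᶠ n : ℕ in atTop, ∀ z k : ℕ, z < p ^ n → k < p →
      ‖∑ w ∈ C (n + 1) \ C n, Fh w * gh w * w ^ (-((z : ℤ) + (p : ℤ) ^ n * k)) +
        (p : K) ^ n * (((k : K) - cst p K) * Ufn f g' z)‖ ≤ η * ‖(p : K) ^ n‖ := by
  have hpK : (p : K) ≠ 0 := p_ne hiso
  have hp0 : (0 : ℝ) < p := by exact_mod_cast hp.out.pos
  obtain ⟨B1, hB1, hb1⟩ := ev_bdd (ud_cont hiso hf)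
  obtain ⟨B4, hB4, hb4⟩ := ev_bdd (ud_cont' hiso hg)
  obtain ⟨B, hB, bf, bg'⟩ : ∃ B : ℝ, 1 ≤ B ∧ (∀ x, ‖f x‖ ≤ B) ∧ (∀ x, ‖g' x‖ ≤ B) :=
    ⟨B1 + B4, by linarith, fun x => by linarith [hb1 x], fun x => by linarith [hb4 x]⟩
  obtain ⟨ε, hε, hε1, hεη⟩ : ∃ ε : ℝ, 0 < ε ∧ ε ≤ 1 ∧ p * (4 * B * ε) ≤ η := by
    refine ⟨min 1 (η / (4 * B * p)), by positivity, min_le_left _ _, ?_⟩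
    calc (p : ℝ) * (4 * B * min 1 (η / (4 * B * p))) ≤ p * (4 * B * (η / (4 * B * p))) := by
          gcongr; exact min_le_right _ _
      _ = η := by field_simp
  have hεB : ε ≤ B * ε := by nlinarith
  filter_upwards [e_est hiso hC hCcard hF hFh hε, e_est hiso hC hCcard hg hgh hε,
    ev_uc (ud_cont' hiso hg) hε,
    total_small hiso (ud_cont hiso hf) (ud_cont' hiso hg) hε] with n hEf hEg huc ht1 z k hz hk
  have hPn0 : (p : K) ^ n ≠ 0 := pow_ne_zero _ hpK
  set W := C (n + 1) \ C n with hWdef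
  have hW : ∀ w ∈ W, w ^ p ^ (n + 1) = 1 := fun w hw => (hC _ w).1 (Finset.mem_sdiff.1 hw).1
  rw [conv_fourier hpK hW, pow_succ p n, sum_range_mul_split]
  have hpt : ∀ i ∈ Finset.range p, ∀ a ∈ Finset.range (p ^ n), ∃ e : K, ‖e‖ ≤ 4 * B * ε ∧
      Efn W Fh ((a + p ^ n * i : ℕ) : ℤ) * Efn W gh ((z : ℤ) + (p : ℤ) ^ n * k - ((a + p ^ n * i : ℕ) : ℤ))
      = (p : K) ^ n * (p : K) ^ n * (e + (f a * g' ((z : ℤ_[p]) - a)) * (((i : K) - cst p K) *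
          ((((((k : ℤ) - if a < z + 1 then 0 else 1) - i) % p : ℤ) : K) - cst p K))) := by
    intro i hi a ha
    rw [Finset.mem_range] at hi ha
    obtain ⟨kk, hkk⟩ : ∃ kk : ℤ, kk = (k : ℤ) - if a < z + 1 then 0 else 1 := ⟨_, rfl⟩
    rw [← hkk]
    obtain ⟨b, s, hblt, hbz, hbp⟩ : ∃ (b : ℕ) (s : ℤ_[p]), b < p ^ n ∧
        (b : ℤ) + (p : ℤ) ^ n * kk = z - a + (p : ℤ) ^ n * k ∧
        (b : ℤ_[p]) = z - a + (p : ℤ_[p]) ^ n * s := by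
      by_cases h : a < z + 1
      · refine ⟨z - a, 0, by omega, ?_, ?_⟩
        · rw [hkk, if_pos h, Nat.cast_sub (by omega)]; ring
        · rw [Nat.cast_sub (by omega)]; ring
      · refine ⟨z + p ^ n - a, 1, by omega, ?_, ?_⟩
        · rw [hkk, if_neg h, Nat.cast_sub (by omega)]; push_cast; ring
        · rw [Nat.cast_sub (by omega)]; push_cast; ring
    have hpz : (0 : ℤ) < p := by exact_mod_cast hp.out.pos
    obtain ⟨j, hj⟩ := Int.eq_ofNat_of_zero_le (Int.emod_nonneg (kk - i) hpz.ne')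
    have hjlt : j < p := by
      have := Int.emod_lt_of_pos (kk - i) hpz
      omega
    have hdm := Int.emod_add_mul_ediv (kk - i) p
    have hcong : Efn W gh ((z : ℤ) + (p : ℤ) ^ n * k - ((a + p ^ n * i : ℕ) : ℤ)) =
        Efn W gh ((b : ℤ) + (p : ℤ) ^ n * j) := by
      apply Efn_cong (n := n + 1) hW
      refine ⟨(kk - i) / p, ?_⟩
      rw [hj] at hdm
      push_cast
      linear_combination (-(p : ℤ) ^ n) * hdm - hbz
    rw [hcong, hj]
    push_cast
    obtain ⟨α, hα, eα⟩ := factor hPn0 (hEf a i ha hi)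
    obtain ⟨β, hβ, eβ⟩ := factor hPn0 (hEg b j hblt hjlt)
    have hκ := huc (z - a) s
    rw [← hbp] at hκ
    obtain ⟨κ, eκ⟩ : ∃ κ : K, κ = g' b - g' (z - a) := ⟨_, rfl⟩
    rw [← eκ] at hκ
    have hdi := dig_le' (K := K) hiso i
    have hdj := dig_le' (K := K) hiso j
    have hE : Efn W Fh ((a : ℤ) + (p : ℤ) ^ n * i) = (p : K) ^ n * (f a * ((i : K) - cst p K) + α) := by
      linear_combination eα
    have hG : Efn W gh ((b : ℤ) + (p : ℤ) ^ n * j) = (p : K) ^ n * (g' b * ((j : K) - cst p K) + β) := by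
      linear_combination eβ
    refine ⟨f a * (((i : K) - cst p K) * (κ * ((j : K) - cst p K) + β)) +
      α * (g' b * ((j : K) - cst p K) + β), ?_, ?_⟩
    · refine max3 ?_ ?_
      · refine (nmul (B := 2 * (2 * ε)) (by linarith) (bf _) (nmul (by norm_num) hdi
          (max3 ?_ (by linarith)))).trans (by linarith)
        exact (nmul hε.le hκ hdj).trans (by linarith)
      · refine (nmul (B := B * 2) hε.le hα (max3 (nmul (by linarith) (bg' _) hdj) (by linarith))).trans
          (by nlinarith)
    · rw [hE, hG]
      have : g' b = g' (z - a) + κ := by rw [eκ]; ring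
      rw [this]
      ring
  choose! e he hpe using hpt
  rw [Finset.sum_congr rfl fun i hi => Finset.sum_congr rfl fun a ha => hpe i hi a ha]
  have hU : Ufn f g' z = ∑ a ∈ Finset.range (p ^ n), (if a < z + 1 then 1 else 0) *
      (f (a : ℤ_[p]) * g' ((z : ℤ_[p]) - a)) := by
    rw [Ufn]
    simp only [ite_mul, one_mul, zero_mul]
    rw [← Finset.sum_filter]
    congr 1
    ext a; simp only [Finset.mem_range, Finset.mem_filter]; omega
  have hmain : ∑ i ∈ Finset.range p, ∑ a ∈ Finset.range (p ^ n), (f a * g' ((z : ℤ_[p]) - a)) *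
      (((i : K) - cst p K) *
          ((((((k : ℤ) - if a < z + 1 then 0 else 1) - i) % p : ℤ) : K) - cst p K)) =
      -(p : K) * ((k : K) - cst p K) * Ufn f g' z + Sfn p K ((k : ℤ) - 1) *
        ∑ a ∈ Finset.range (p ^ n), f (0 + a) * g' ((z : ℤ_[p]) - a) := by
    rw [Finset.sum_comm, hU, ← S_diff hiso k hk, Finset.mul_sum, Finset.mul_sum,
      ← Finset.sum_add_distrib]
    refine Finset.sum_congr rfl fun a _ => ?_
    rw [← Finset.mul_sum, zero_add]
    split_ifs
    · rw [sub_zero, ← Sfn]; ring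
    · rw [← Sfn]; ring
  obtain ⟨X, hX⟩ : ∃ X : K, X = ∑ i ∈ Finset.range p, ∑ a ∈ Finset.range (p ^ n), e i a +
      Sfn p K ((k : ℤ) - 1) * ∑ a ∈ Finset.range (p ^ n), f (0 + a) * g' ((z : ℤ_[p]) - a) := ⟨_, rfl⟩
  have hXn : ‖X‖ ≤ 4 * B * ε := by
    rw [hX]
    refine max3 (usum (by positivity) fun i hi => usum (by positivity) fun a ha => he i hi a ha) ?_
    exact (nmul (by norm_num) (S_le hiso _) (ht1 0 z)).trans (by linarith)
  have hfin : ((p : K) ^ (n + 1))⁻¹ * ∑ i ∈ Finset.range p, ∑ a ∈ Finset.range (p ^ n),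
      (p : K) ^ n * (p : K) ^ n * (e i a + (f a * g' ((z : ℤ_[p]) - a)) * (((i : K) - cst p K) *
          ((((((k : ℤ) - if a < z + 1 then 0 else 1) - i) % p : ℤ) : K) - cst p K))) +
      (p : K) ^ n * (((k : K) - cst p K) * Ufn f g' z) = (p : K) ^ n * ((p : K)⁻¹ * X) := by
    simp only [← Finset.mul_sum, Finset.sum_add_distrib]
    rw [hmain, hX]
    field_simp
    ring
  rw [hfin, mul_comm η]
  refine nmul (norm_nonneg _) le_rfl ?_
  refine (nmul (A := p) hp0.le ?_ hXn).trans hεη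
  rw [norm_inv, norm_p hiso, inv_inv]

end main2

open Filter Topology

section main3
variable {p : ℕ} [hp : Fact p.Prime] {K : Type*} [NormedField K] [Algebra ℚ_[p] K]
  [IsUltrametricDist K]

variable (hiso : ∀ x : ℚ_[p], ‖algebraMap ℚ_[p] K x‖ = ‖x‖)
  {C : ℕ → Finset K} (hC : ∀ n : ℕ, ∀ w : K, w ∈ C n ↔ w ^ p ^ n = 1)
    (hCcard : ∀ n : ℕ, (C n).card = p ^ n)
  {F f f' g g' : ℤ_[p] → K} {Fh gh : K → K}

include hiso

lemma U_diff (hf : Continuous f) (hg : Continuous g') (z : ℕ) {η : ℝ} (hη : 0 < η) :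
    ∀ᶠ m : ℕ in atTop, ‖Ufn f g' (z + p ^ m) - Ufn f g' z‖ ≤ η := by
  obtain ⟨B, hB1, hB⟩ := ev_bdd hf
  have hB0 : 0 < B := by linarith
  filter_upwards [ev_uc hg (ε := η / B) (by positivity), total_small hiso hf hg hη] with m h1 h2
  have e : Ufn f g' (z + p ^ m) - Ufn f g' z =
      ∑ a ∈ Finset.range (z + 1), f a * (g' (((z : ℤ_[p]) - a) + (p : ℤ_[p]) ^ m * 1) - g' ((z : ℤ_[p]) - a))
      + ∑ a ∈ Finset.range (p ^ m), f (((z : ℤ_[p]) + 1) + a) * g' (((p : ℤ_[p]) ^ m - 1) - a) := by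
    rw [Ufn, Ufn, show z + p ^ m + 1 = (z + 1) + p ^ m by ring, Finset.sum_range_add]
    simp only [mul_sub, Finset.sum_sub_distrib]
    rw [add_sub_right_comm]
    congr 1
    · congr 1
      refine Finset.sum_congr rfl fun a _ => ?_
      congr 2
      push_cast; ring
    · refine Finset.sum_congr rfl fun a _ => ?_
      congr 2 <;> (push_cast; ring)
  rw [e]
  refine max3 (usum hη.le fun a _ => ?_) (h2 _ _)
  refine (nmul hB0.le (hB _) (h1 _ 1)).trans ?_
  rw [mul_div_cancel₀ _ hB0.ne']

include hC hCcard

lemma H_est (hF : IsUnifDiff F f) (hf : IsUnifDiff f f') (hg : IsUnifDiff g g')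
    (hFh : HFC p F Fh) (hgh : HFC p g gh) (z : ℕ) {η : ℝ} (hη : 0 < η) :
    ∀ᶠ m : ℕ in atTop, ∀ n, m + 1 ≤ n →
      ‖(∑ w ∈ C n, Fh w * gh w * w ^ (-((z + p ^ m : ℕ) : ℤ))) - (∑ w ∈ C n, Fh w * gh w * w ^ (-(z : ℤ)))
        + (p : K) ^ m * Ufn f g' z‖ ≤ η * ‖(p : K) ^ m‖ := by
  classical
  have hD := D_est hiso hC hCcard hF hf hg hFh hgh hη
  rw [eventually_atTop] at hD
  obtain ⟨n0, hD⟩ := hD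
  filter_upwards [eventually_ge_atTop n0, eventually_ge_atTop z,
    U_diff hiso (ud_cont hiso hf) (ud_cont' hiso hg) z (half_pos hη)] with m hm0 hmz hU n hn
  have hzm : z < p ^ m := hmz.trans_lt (Nat.lt_pow_self hp.out.one_lt)
  have hsplit : ∀ (n : ℕ) (y : ℤ), ∑ w ∈ C (n + 1), Fh w * gh w * w ^ y =
      ∑ w ∈ C (n + 1) \ C n, Fh w * gh w * w ^ y + ∑ w ∈ C n, Fh w * gh w * w ^ y := fun n y =>
    (Finset.sum_sdiff (C_mono hC n)).symm
  induction n, hn using Nat.le_induction with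
  | base =>
    rw [hsplit, hsplit]
    have hc : ∑ w ∈ C m, Fh w * gh w * w ^ (-((z + p ^ m : ℕ) : ℤ)) =
        ∑ w ∈ C m, Fh w * gh w * w ^ (-(z : ℤ)) := by
      refine Finset.sum_congr rfl fun w hw => ?_
      rw [zpow_cong ((hC m w).1 hw) (a := -((z + p ^ m : ℕ) : ℤ)) (b := -(z : ℤ))]
      exact ⟨-1, by push_cast; ring⟩
    rw [hc]
    have h1 := hD m hm0 z 1 hzm hp.out.one_lt
    have h0 := hD m hm0 z 0 hzm hp.out.pos
    rw [show (z : ℤ) + (p : ℤ) ^ m * (1 : ℕ) = ((z + p ^ m : ℕ) : ℤ) by push_cast; ring] at h1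
    rw [show (z : ℤ) + (p : ℤ) ^ m * (0 : ℕ) = (z : ℤ) by push_cast; ring] at h0
    refine le_of_eq_of_le ?_ (max3' h1 h0)
    congr 1
    push_cast; ring
  | succ n hn ih =>
    rw [hsplit, hsplit]
    have hle : p ^ (m + 1) ≤ p ^ n := Nat.pow_le_pow_right hp.out.pos hn
    have h2 : 2 * p ^ m ≤ p ^ (m + 1) := by
      rw [pow_succ, mul_comm]; exact Nat.mul_le_mul_left _ hp.out.two_le
    have h1 := hD n (by omega) (z + p ^ m) 0 (by omega) hp.out.pos
    have h0 := hD n (by omega) z 0 (by omega) hp.out.pos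
    rw [show ((z + p ^ m : ℕ) : ℤ) + (p : ℤ) ^ n * (0 : ℕ) = ((z + p ^ m : ℕ) : ℤ) by push_cast; ring] at h1
    rw [show (z : ℤ) + (p : ℤ) ^ n * (0 : ℕ) = (z : ℤ) by push_cast; ring] at h0
    have hPn : ‖(p : K) ^ n‖ ≤ ‖(p : K) ^ m‖ := by
      rw [norm_pow, norm_pow]
      exact pow_le_pow_of_le_one (norm_nonneg _) (norm_nat_le hiso p) (by omega)
    have h3 := max3' h1 h0
    have h4 : ‖(p : K) ^ n * (cst p K * (Ufn f g' (z + p ^ m) - Ufn f g' z))‖ ≤ η * ‖(p : K) ^ n‖ :=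
      (nmul (norm_nonneg _) le_rfl (nmul (by norm_num) (cst_le hiso) hU)).trans (le_of_eq (by ring))
    have h5 := (max3 h3 h4).trans (mul_le_mul_of_nonneg_left hPn hη.le)
    refine le_of_eq_of_le ?_ (max3 ih h5)
    congr 1
    push_cast; ring

lemma deriv_val (hF : IsUnifDiff F f) (hf : IsUnifDiff f f') (hg : IsUnifDiff g g')
    (hFh : HFC p F Fh) (hgh : HFC p g gh) {M : K} {G G' : ℤ_[p] → K} (hG : IsUnifDiff G G')
    (hlim : ∀ z : ℤ_[p], Tendsto (fun n : ℕ => ∑ w ∈ C n, Fh w * gh w * phi w⁻¹ n z) atTop (𝓝 (M * G z)))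
    (z : ℕ) : M * G' z + Ufn f g' z = 0 := by
  have hlim' : ∀ y : ℕ, Tendsto (fun n : ℕ => ∑ w ∈ C n, Fh w * gh w * w ^ (-(y : ℤ))) atTop
      (𝓝 (M * G (y : ℤ_[p]))) := by
    intro y
    refine (hlim y).congr fun n => Finset.sum_congr rfl fun w hw => ?_
    rw [phi_nat (by rw [inv_pow, (hC n w).1 hw, inv_one]), zpow_neg, zpow_natCast, inv_pow]
  rw [← norm_le_zero_iff]
  refine le_of_forall_pos_le_add fun η hη => ?_
  rw [zero_add]
  have hM : 0 < 1 + ‖M‖ := by positivity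
  obtain ⟨m, h1, h2⟩ := ((H_est hiso hC hCcard hF hf hg hFh hgh z hη).and
    (ev_ud hiso hG (ε := η / (1 + ‖M‖)) (by positivity))).exists
  have h3 : ‖M * G ((z + p ^ m : ℕ) : ℤ_[p]) - M * G z + (p : K) ^ m * Ufn f g' z‖ ≤ η * ‖(p : K) ^ m‖ := by
    refine le_of_tendsto (((hlim' (z + p ^ m)).sub (hlim' z)).add_const _).norm ?_
    filter_upwards [eventually_ge_atTop (m + 1)] with n hn
    exact h1 n hn
  have h4 := h2 z 1
  rw [mul_one, emb_one, mul_one] at h4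
  have h5 : ‖M * (G ((z : ℤ_[p]) + (p : ℤ_[p]) ^ m) - G z - (p : K) ^ m * G' z)‖ ≤ η * ‖(p : K) ^ m‖ := by
    refine (nmul (norm_nonneg _) le_rfl h4).trans ?_
    rw [← mul_assoc]
    gcongr
    rw [mul_div_assoc', div_le_iff₀ hM]
    nlinarith [norm_nonneg M]
  have h6 := max3' h3 h5
  have e : M * G ((z + p ^ m : ℕ) : ℤ_[p]) - M * G z + (p : K) ^ m * Ufn f g' z -
      M * (G ((z : ℤ_[p]) + (p : ℤ_[p]) ^ m) - G z - (p : K) ^ m * G' z) =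
      (M * G' z + Ufn f g' z) * (p : K) ^ m := by
    push_cast; ring
  rw [e, norm_mul] at h6
  exact le_of_mul_le_mul_right h6 (norm_pos_iff.2 (pow_ne_zero _ (p_ne hiso)))

end main3

lemma appr_tendsto {p : ℕ} [hp : Fact p.Prime] (z : ℤ_[p]) :
    Tendsto (fun n => ((z.appr n : ℕ) : ℤ_[p])) atTop (𝓝 z) := by
  rw [Metric.tendsto_nhds]
  intro ε hε
  filter_upwards [ev_small (p := p) (half_pos hε)] with n hn
  obtain ⟨t, ht⟩ := appr_cong n z
  rw [dist_comm, dist_eq_norm]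
  nth_rw 1 [ht]
  rw [add_sub_cancel_left]
  exact (hn t).trans_lt (half_lt_self hε)


/-- Kim's formula `f *_q g (z) = ((q-1)/log q) I_q^{(x)}(f(x)g(z-x)φ_{q⁻¹}(x)) - (f ⊗_q g')(z)`,
where `f ⊗_q g' := -(F *_q g)'` for `F' = f`. -/
theorem stmt1 {p : ℕ} [Fact p.Prime] {K : Type*} [NormedField K] [CompleteSpace K]
    [IsUltrametricDist K] [Algebra ℚ_[p] K]
    (hiso : ∀ x : ℚ_[p], ‖algebraMap ℚ_[p] K x‖ = ‖x‖)
    (L : K) (hL0 : 0 < ‖L‖) (hL1 : ‖L‖ < (p : ℝ) ^ (-1 / ((p : ℝ) - 1)))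
    (C : ℕ → Finset K) (hC : ∀ n : ℕ, ∀ w : K, w ∈ C n ↔ w ^ p ^ n = 1)
    (hCcard : ∀ n : ℕ, (C n).card = p ^ n)
    (f f' g g' F : ℤ_[p] → K)
    (hf : IsUnifDiff f f') (hg : IsUnifDiff g g') (hF : IsUnifDiff F f)
    (fc gc Fc : K → K)
    (hfc : ∀ (n : ℕ) (w : K), w ^ p ^ n = 1 →
      HasIq p L (fun x => phi w n x * qpow L (-x) * f x) (fc w))
    (hgc : ∀ (n : ℕ) (w : K), w ^ p ^ n = 1 →
      HasIq p L (fun x => phi w n x * qpow L (-x) * g x) (gc w))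
    (hFc : ∀ (n : ℕ) (w : K), w ^ p ^ n = 1 →
      HasIq p L (fun x => phi w n x * qpow L (-x) * F x) (Fc w))
    (conv Fconv : ℤ_[p] → K)
    (hconv : ∀ z : ℤ_[p],
      Tendsto (fun n : ℕ => ∑ w ∈ C n, fc w * gc w * phi w⁻¹ n z) atTop (nhds (conv z)))
    (hFconv : ∀ z : ℤ_[p],
      Tendsto (fun n : ℕ => ∑ w ∈ C n, Fc w * gc w * phi w⁻¹ n z) atTop (nhds (Fconv z)))
    (Fconv' : ℤ_[p] → K) (hFconv' : IsUnifDiff Fconv Fconv')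
    (A : ℤ_[p] → K)
    (hA : ∀ z : ℤ_[p], HasIq p L (fun x => f x * g (z - x) * qpow L (-x)) (A z)) :
    ∀ z : ℤ_[p], conv z = ((pExp L - 1) / L) * A z + Fconv' z := by
  intro z
  have hq := exp_ne_one hiso hL0 hL1
  have hLne : L ≠ 0 := norm_pos_iff.1 hL0
  obtain ⟨M, hM⟩ : ∃ M : K, M = L / (pExp L - 1) := ⟨_, rfl⟩
  have hM0 : M ≠ 0 := by rw [hM]; exact div_ne_zero hLne hq
  have key : ∀ (h : ℤ_[p] → K) (hc : K → K), (∀ (n : ℕ) (w : K), w ^ p ^ n = 1 →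
      HasIq p L (fun x => phi w n x * qpow L (-x) * h x) (hc w)) → HFC p h (fun w => M * hc w) := by
    intro h hc hh n w hw
    have h1 := hh n w hw
    have e : (fun x : ℤ_[p] => phi w n x * qpow L (-x) * h x) =
        fun x => (phi w n x * h x) * qpow L (-x) := by
      funext x; ring
    rw [e] at h1
    rw [hM]
    exact hasIq_iff hiso hL0 hL1 (fun x => phi w n x * h x) _ h1
  have kf := key f fc hfc
  have kg := key g gc hgc
  have kF := key F Fc hFc
  have kA := hasIq_iff hiso hL0 hL1 (fun x => f x * g (z - x)) _ (hA z)
  rw [← hM] at kA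
  have scale : ∀ (hc : K → K) (l : K) (y : ℤ_[p]),
      Tendsto (fun n : ℕ => ∑ w ∈ C n, hc w * gc w * phi w⁻¹ n y) atTop (𝓝 l) →
      Tendsto (fun n : ℕ => ∑ w ∈ C n, (M * hc w) * (M * gc w) * phi w⁻¹ n y) atTop (𝓝 (M ^ 2 * l)) := by
    intro hc l y h
    refine (h.const_mul (M ^ 2)).congr fun n => ?_
    rw [Finset.mul_sum]
    exact Finset.sum_congr rfl fun w _ => by ring
  have hU : ∀ y : ℕ, M ^ 2 * Fconv' y + Ufn f g' y = 0 :=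
    deriv_val hiso hC hCcard hF hf hg kF kg hFconv' fun y => scale Fc _ y (hFconv y)
  have h1 := conv_est hiso hC hCcard hf hg kf kg z
  have h2 : Tendsto (fun n : ℕ => Ufn f g' (z.appr n)) atTop (𝓝 (-(M ^ 2 * Fconv' z))) := by
    have h3 := (((ud_cont' hiso hFconv').tendsto z).comp (appr_tendsto z)).const_mul (M ^ 2)
    refine h3.neg.congr fun n => ?_
    have := hU (z.appr n)
    simp only [Function.comp]
    linear_combination -this
  have h4 := tendsto_nhds_unique h1 (((scale fc _ z (hconv z)).sub kA).add h2)
  have hinv : (pExp L - 1) / L = M⁻¹ := by rw [hM, inv_div]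
  rw [hinv]
  have h5 : M ^ 2 * (conv z - M⁻¹ * A z - Fconv' z) = 0 := by
    have : M ^ 2 * M⁻¹ = M := by field_simp
    linear_combination -h4 - A z * this
  have h6 := (mul_eq_zero.1 h5).resolve_left (pow_ne_zero _ hM0)
  linear_combination h6
end
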